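/- arXiv:1207.5643 — 5 statements merged into one kernel-verified Lean document; each statement's English description precedes it below -/
import Mathlib

section
/- Let D be a strongly connected digraph on n ≥ 5 vertices with minimum semi-degree at least 2 that satisfies condition (*). If D contains no cycle of length n − 1, then D contains a cycle of length exactly n − 2; equivalently, every longest non-Hamiltonian cycle of D has length n − 2. -/
/-!
Digraphs are modelled as a finite vertex type `V` together with an arc relation
`A : V → V → Prop` (irreflexive, i.e. no loops; no multiple arcs by construction).
-/

namespace PaperDG

variable {V : Type*}

/-- Out-degree of `v`: the number of out-neighbours. -/
noncomputable def outDeg (A : V → V → Prop) (v : V) : ℕ := Nat.card {w : V // A v w}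

/-- In-degree of `v`: the number of in-neighbours. -/
noncomputable def inDeg (A : V → V → Prop) (v : V) : ℕ := Nat.card {w : V // A w v}

/-- Degree `d(v) = d⁺(v) + d⁻(v)`. -/
noncomputable def deg (A : V → V → Prop) (v : V) : ℕ := outDeg A v + inDeg A v

/-- Strong connectivity: every vertex reaches every other by a directed path. -/
def IsStrong (A : V → V → Prop) : Prop := ∀ x y : V, Relation.ReflTransGen A x y

/-- The digraph has a directed cycle through `k` distinct vertices. -/
def HasCycle (A : V → V → Prop) (k : ℕ) : Prop :=
  ∃ f : ZMod k → V, Function.Injective f ∧ ∀ i : ZMod k, A (f i) (f (i + 1))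

/-- Condition (*): `d(x) + d(y) ≥ 2n - 1` and `min {d(x), d(y)} ≥ n - 1` for every pair of
non-adjacent vertices `x, y` with a common in-neighbour. -/
def CondStar [Fintype V] (A : V → V → Prop) : Prop :=
  ∀ x y : V, x ≠ y → ¬A x y → ¬A y x → (∃ u : V, A u x ∧ A u y) →
    2 * Fintype.card V - 1 ≤ deg A x + deg A y ∧
      Fintype.card V - 1 ≤ min (deg A x) (deg A y)

/-- Condition (**): `min {d⁺(x) + d⁻(y), d⁻(x) + d⁺(y)} ≥ n` for every pair of non-adjacent
vertices `x, y` with a common in-neighbour or a common out-neighbour. -/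
def CondStarStar [Fintype V] (A : V → V → Prop) : Prop :=
  ∀ x y : V, x ≠ y → ¬A x y → ¬A y x →
    ((∃ u : V, A u x ∧ A u y) ∨ (∃ u : V, A x u ∧ A y u)) →
    Fintype.card V ≤ min (outDeg A x + inDeg A y) (inDeg A x + outDeg A y)

/-- The digraph is (isomorphic to) the complete bipartite digraph `K*_{n/2,n/2}`:
there is a part `S` of size `n/2` such that the arcs are exactly the pairs of vertices
lying in different parts. -/
def IsKhalf [Fintype V] (A : V → V → Prop) : Prop :=
  ∃ S : Set V, 2 * Nat.card S = Fintype.card V ∧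
    ∀ x y : V, A x y ↔ (x ∈ S ↔ y ∉ S)

/-- The digraph is (isomorphic to) `K*_{n/2,n/2}` minus one arc. -/
def IsKhalfMinusArc [Fintype V] (A : V → V → Prop) : Prop :=
  ∃ S : Set V, ∃ a b : V, 2 * Nat.card S = Fintype.card V ∧ (a ∈ S ↔ b ∉ S) ∧
    ∀ x y : V, A x y ↔ ((x ∈ S ↔ y ∉ S) ∧ ¬(x = a ∧ y = b))

/-- Minimum semi-degree at least `k`. -/
def MinSemiDegreeGE (A : V → V → Prop) (k : ℕ) : Prop :=
  ∀ v : V, k ≤ outDeg A v ∧ k ≤ inDeg A v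

/-- Locally semicomplete: for every vertex `x` the out-neighbourhood and the
in-neighbourhood of `x` both induce semicomplete digraphs. -/
def LocallySemicomplete (A : V → V → Prop) : Prop :=
  ∀ x u v : V, u ≠ v →
    ((A x u → A x v → A u v ∨ A v u) ∧ (A u x → A v x → A u v ∨ A v u))

end PaperDG

open PaperDG

namespace DKAux
open List

/-- directed path given as a list with prescribed ends -/
def Pth {V : Type*} (A : V → V → Prop) (a : V) (L : List V) (b : V) : Prop :=
  L.IsChain A ∧ L.head? = some a ∧ L.getLast? = some b

open Classical in
/-- number of arcs between `v` and the list -/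
noncomputable def dl {V : Type*} (A : V → V → Prop) (v : V) (l : List V) : ℕ :=
  l.countP (fun w => decide (A v w)) + l.countP (fun w => decide (A w v))

/-- `v` cannot be inserted in the list -/
def NI {V : Type*} (A : V → V → Prop) (v : V) (L : List V) : Prop :=
  L.IsChain (fun a b => ¬(A a v ∧ A v b))

section
variable {V : Type*} {A : V → V → Prop}

theorem Pth.single (a : V) : Pth A a [a] a := by simp [Pth]

theorem Pth.ne_nil {a b : V} {L : List V} (h : Pth A a L b) : L ≠ [] := by
  rintro rfl; simp [Pth] at h

theorem Pth.append {a b c d : V} {L M : List V} (h : Pth A a L b) (hA : A b c)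
    (h' : Pth A c M d) : Pth A a (L ++ M) d := by
  obtain ⟨h1, h2, h3⟩ := h
  obtain ⟨k1, k2, k3⟩ := h'
  refine ⟨?_, ?_, ?_⟩
  · rw [List.isChain_append]
    refine ⟨h1, k1, ?_⟩
    intro x hx y hy
    simp_all
  · simp [List.head?_append, h2]
  · simp [List.getLast?_append, k3]

theorem Pth.snoc {a b c : V} {L : List V} (h : Pth A a L b) (hA : A b c) :
    Pth A a (L ++ [c]) c := h.append hA (Pth.single c)

theorem Pth.cons {a b c : V} {L : List V} (h : Pth A a L b) (hA : A c a) :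
    Pth A c (c :: L) b := (Pth.single c).append hA h

theorem Pth.mem_left {a b : V} {L : List V} (h : Pth A a L b) : a ∈ L :=
  List.mem_of_mem_head? (by simp [h.2.1])

theorem Pth.mem_right {a b : V} {L : List V} (h : Pth A a L b) : b ∈ L :=
  List.mem_of_mem_getLast? (by simp [h.2.2])

theorem Pth.split {a b : V} {L M : List V} (h : Pth A a (L ++ M) b) (hL : L ≠ []) (hM : M ≠ []) :
    ∃ c d, Pth A a L c ∧ A c d ∧ Pth A d M b := by
  obtain ⟨h1, h2, h3⟩ := h
  rw [List.isChain_append] at h1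
  obtain ⟨k1, k2, k3⟩ := h1
  obtain ⟨d, hd⟩ : ∃ d, M.head? = some d := by
    cases M with
    | nil => exact absurd rfl hM
    | cons d _ => exact ⟨d, rfl⟩
  obtain ⟨c, hc⟩ : ∃ c, L.getLast? = some c := ⟨_, List.getLast?_eq_some_getLast hL⟩
  refine ⟨c, d, ⟨k1, ?_, hc⟩, k3 c (by simp [hc]) d (by simp [hd]), ⟨k2, hd, ?_⟩⟩
  · cases L with
    | nil => exact absurd rfl hL
    | cons x _ => simpa using h2
  · rw [List.getLast?_append_of_ne_nil _ hM] at h3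
    exact h3

/-- head of an explicit cons -/
theorem Pth.head_eq {a b x : V} {L : List V} (h : Pth A a (x :: L) b) : a = x := by
  have := h.2.1; simp at this; exact this.symm

theorem Pth.last_eq {a b x : V} {L : List V} (h : Pth A a (L ++ [x]) b) : b = x := by
  have := h.2.2; simp at this; exact this.symm

/-- prefix up to an element -/
theorem Pth.pre {a b x : V} {L M : List V} (h : Pth A a (L ++ x :: M) b) :
    Pth A a (L ++ [x]) x := by
  by_cases hM : M = []
  · subst hM
    have := h.last_eq
    rwa [this] at h
  · have h' : Pth A a ((L ++ [x]) ++ M) b := by simpa using h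
    obtain ⟨c, d, h1, h2, h3⟩ := h'.split (by simp) hM
    have := h1.last_eq
    rwa [this] at h1

theorem Pth.suf {a b x : V} {L M : List V} (h : Pth A a (L ++ x :: M) b) :
    Pth A x (x :: M) b := by
  by_cases hL : L = []
  · subst hL
    have := h.head_eq
    subst this
    exact h
  · obtain ⟨c, d, h1, h2, h3⟩ := h.split hL (by simp)
    have := h3.head_eq
    rwa [this] at h3

theorem Pth.of_last {x : V} {L : List V} (h : L.getLast? = some x) (hc : L.IsChain A) :
    ∃ a, Pth A a L x := by
  cases L with
  | nil => simp at h
  | cons a l => exact ⟨a, hc, rfl, h⟩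

theorem not_isChain {R : V → V → Prop} : ∀ {L : List V}, ¬ L.IsChain R →
    ∃ L1 x y L2, L = L1 ++ x :: y :: L2 ∧ ¬ R x y
  | [], h => absurd .nil h
  | [a], h => absurd (.singleton a) h
  | a :: b :: l, h => by
    by_cases hab : R a b
    · have : ¬ (b :: l).IsChain R := fun h' => h (by simp [hab, h'])
      obtain ⟨L1, x, y, L2, h1, h2⟩ := not_isChain this
      exact ⟨a :: L1, x, y, L2, by simp [h1], h2⟩
    · exact ⟨[], a, b, l, rfl, hab⟩

theorem insert_of_not_NI {v a b : V} {L : List V} (h : Pth A a L b) (hn : ¬ NI A v L) :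
    ∃ Q, Pth A a Q b ∧ Q.Perm (v :: L) := by
  obtain ⟨L1, x, y, L2, rfl, h2⟩ := not_isChain hn
  push Not at h2
  have h1 := h.pre
  have h3 : Pth A y (y :: L2) b := by
    have h' : Pth A a ((L1 ++ [x]) ++ y :: L2) b := by simpa using h
    exact h'.suf
  refine ⟨(L1 ++ [x]) ++ (v :: (y :: L2)), h1.append h2.1 (h3.cons h2.2), ?_⟩
  classical
  rw [List.perm_iff_count]
  intro c
  simp [List.count_cons, List.count_append]
  omega

theorem dl_append (v : V) (l m : List V) : dl A v (l ++ m) = dl A v l + dl A v m := by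
  simp [dl, List.countP_append]; omega

theorem dl_perm (v : V) {l m : List V} (h : l.Perm m) : dl A v l = dl A v m := by
  simp [dl, h.countP_eq]

theorem dl_cons (v w : V) (m : List V) : dl A v (w :: m) = dl A v [w] + dl A v m := by
  rw [← dl_append]; rfl

theorem dl_single_le (v w : V) : dl A v [w] ≤ 2 := by
  classical
  simp only [dl]
  have := List.countP_le_length (p := fun w => decide (A v w)) (l := [w])
  have := List.countP_le_length (p := fun w => decide (A w v)) (l := [w])
  simp at *
  omega

theorem dl_nonadj {v w : V} (h1 : ¬ A v w) (h2 : ¬ A w v) : dl A v [w] = 0 := by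
  simp [dl, h1, h2]

theorem dl_eq_zero {v : V} {l : List V} (h1 : ∀ w ∈ l, ¬ A v w) (h2 : ∀ w ∈ l, ¬ A w v) :
    dl A v l = 0 := by
  simp only [dl, Nat.add_eq_zero_iff, List.countP_eq_zero, decide_eq_true_eq]
  exact ⟨h1, h2⟩

theorem dl_le (v : V) (l : List V) : dl A v l ≤ 2 * l.length := by
  classical
  simp only [dl]
  have := List.countP_le_length (p := fun w => decide (A v w)) (l := l)
  have := List.countP_le_length (p := fun w => decide (A w v)) (l := l)
  omega

open Classical in
theorem dl_NI_aux (v : V) : ∀ (a : V) (l : List V), NI A v (a :: l) →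
    dl A v (a :: l) ≤ (a :: l).length + (if A v a then 1 else 0)
  | a, [], _ => by
    simp only [dl, List.countP_cons, List.countP_nil, decide_eq_true_eq, List.length_cons,
      List.length_nil]
    split_ifs <;> omega
  | a, b :: l, h => by
    have h1 : ¬ (A a v ∧ A v b) ∧ NI A v (b :: l) := by
      simpa [NI, List.isChain_cons_cons] using h
    have ih := dl_NI_aux v b l h1.2
    rw [dl_cons]
    have h2 := h1.1
    have h3 : dl A v [a] = (if A v a then 1 else 0) + (if A a v then 1 else 0) := by
      simp only [dl, List.countP_cons, List.countP_nil, decide_eq_true_eq]; omega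
    rw [h3]
    simp only [List.length_cons] at *
    split_ifs at * <;> first | omega | tauto

theorem dl_NI {v a b : V} {L : List V} (h : Pth A a L b) (hn : NI A v L) :
    dl A v L ≤ L.length + 1 := by
  cases L with
  | nil => simp [dl]
  | cons x l =>
    have := dl_NI_aux v x l hn
    split_ifs at this <;> omega

theorem dl_NI' {v a b : V} {L : List V} (h : Pth A a L b) (hn : NI A v L) (hv : ¬ A v a) :
    dl A v L ≤ L.length := by
  cases L with
  | nil => simp [dl]
  | cons x l =>
    have h1 := dl_NI_aux v x l hn
    have := h.head_eq
    subst this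
    simpa [hv] using h1

theorem pair_bound {y w : V} (l : List V)
    (hyw : ∀ z ∈ l, ¬ (A y z ∧ A z w)) (hwy : ∀ z ∈ l, ¬ (A w z ∧ A z y)) :
    dl A y l + dl A w l ≤ 2 * l.length := by
  classical
  induction l with
  | nil => simp [dl]
  | cons z l ih =>
    have ih := ih (fun z hz => hyw z (by simp [hz])) (fun z hz => hwy z (by simp [hz]))
    have h1 := hyw z (by simp)
    have h2 := hwy z (by simp)
    rw [dl_cons, dl_cons w]
    have h3 : dl A y [z] + dl A w [z] ≤ 2 := by
      simp only [dl, List.countP_cons, List.countP_nil, decide_eq_true_eq]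
      split_ifs <;> first | omega | tauto
    simp only [List.length_cons]
    omega

theorem pair_bound' {y w : V} (l : List V) (hirr : ∀ v : V, ¬A v v) (hy : y ∈ l)
    (h1 : ¬ A y w) (h2 : ¬ A w y)
    (hyw : ∀ z ∈ l, ¬ (A y z ∧ A z w)) (hwy : ∀ z ∈ l, ¬ (A w z ∧ A z y)) :
    dl A y l + dl A w l + 2 ≤ 2 * l.length := by
  obtain ⟨l1, l2, rfl⟩ := List.append_of_mem hy
  have k := pair_bound (A := A) (y := y) (w := w) (l1 ++ l2)
    (fun z hz => hyw z (by simp at *; tauto)) (fun z hz => hwy z (by simp at *; tauto))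
  have e1 := dl_nonadj (A := A) (hirr y) (hirr y)
  have e2 := dl_nonadj (A := A) h2 h1
  rw [dl_append, dl_append] at *
  rw [dl_cons, dl_cons w]
  simp only [List.length_append, List.length_cons] at *
  omega

end

/-- the standing assumptions, with an abstract degree function `d` -/
structure Ctx {V : Type*} (A : V → V → Prop) (d : V → ℕ) (n m : ℕ) : Prop where
  irr : ∀ v, ¬ A v v
  star : ∀ x y u, x ≠ y → ¬ A x y → ¬ A y x → A u x → A u y →
    2 * n ≤ d x + d y + 1 ∧ n ≤ d x + 1 ∧ n ≤ d y + 1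
  hd : ∀ v (E : List V), E.Nodup → E.length = n → d v = dl A v E
  hmn : m + 3 ≤ n
  hm : 2 ≤ m
  hlen : ∀ E : List V, E.Nodup → E.length ≤ n
  hmax : ∀ L a b, Pth A a L b → A b a → L.Nodup → m < L.length → n ≤ L.length

section
variable {V : Type*} {A : V → V → Prop} {d : V → ℕ} {n m : ℕ}

theorem walk (K : Ctx A d n m) {w : V} : ∀ (Q2 : List V) (z b : V), Pth A z (z :: Q2) b →
    NI A w (z :: Q2) → w ∉ z :: Q2 → A z w → n ≤ d w + 1 ∨ A b w
  | [], z, b, h, _, _, hz => by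
    have : b = z := by have := h.2.2; simp at this; exact this.symm
    subst this
    exact Or.inr hz
  | u :: Q3, z, b, h, hN, hw, hz => by
    have h1 : ¬ (A z w ∧ A w u) ∧ NI A w (u :: Q3) := by
      simpa [NI, List.isChain_cons_cons] using hN
    have hzu : A z u := by have := h.1; simp at this; exact this.1
    have h2 : Pth A u (u :: Q3) b := Pth.suf (L := [z]) h
    by_cases huw : A u w
    · exact walk K Q3 u b h2 h1.2 (by simp at hw ⊢; tauto) huw
    · left
      have := K.star w u z (by simp at hw; tauto) (by tauto) huw hz hzu
      exact this.2.1

theorem walk' (K : Ctx A d n m) {w z a b : V} {Q : List V} (h : Pth A a Q b) (hN : NI A w Q)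
    (hw : w ∉ Q) (hzQ : z ∈ Q) (hz : A z w) : n ≤ d w + 1 ∨ A b w := by
  obtain ⟨Q1, Q2, rfl⟩ := List.append_of_mem hzQ
  refine walk K Q2 z b h.suf ?_ (by simp at hw ⊢; tauto) hz
  exact (List.isChain_append.1 hN).2.1

end
section
variable {V : Type*}

open Classical in
/-- indicator -/
noncomputable def dlt (c x : V) : ℕ := if x = c then 1 else 0

/-- multiplicity -/
noncomputable def ct (c : V) : List V → ℕ
  | [] => 0
  | x :: l => dlt c x + ct c l

theorem ct_nil (c : V) : ct c [] = 0 := rfl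
theorem ct_cons (c x : V) (l : List V) : ct c (x :: l) = dlt c x + ct c l := rfl
theorem ct_append (c : V) (l l' : List V) : ct c (l ++ l') = ct c l + ct c l' := by
  induction l with
  | nil => simp [ct]
  | cons x l ih => simp [ct, ih]; omega

theorem ct_mem (c : V) {s : V} {l : List V} (h : s ∈ l) : dlt c s ≤ ct c l := by
  obtain ⟨a, b, rfl⟩ := List.append_of_mem h
  simp only [ct_append, ct_cons]; omega

theorem ct_pos (c : V) (l : List V) : 0 < ct c l ↔ c ∈ l := by
  induction l with
  | nil => simp [ct]
  | cons x l ih =>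
    simp only [ct, dlt, List.mem_cons]
    split_ifs with h
    · simp [h]
    · simp [ih, Ne.symm h]

theorem nd_iff (l : List V) : l.Nodup ↔ ∀ c, ct c l ≤ 1 := by
  induction l with
  | nil => simp [ct]
  | cons x l ih =>
    rw [List.nodup_cons, ih, ← ct_pos]
    constructor
    · rintro ⟨h1, h2⟩ c
      simp only [ct, dlt]
      have := h2 c
      split_ifs with h
      · subst h; omega
      · omega
    · intro h
      refine ⟨?_, fun c => ?_⟩
      · have := h x
        simp only [ct, dlt] at this
        simp at this
        omega
      · have := h c
        simp only [ct] at this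
        omega

theorem nd_of {l big : List V} (h : big.Nodup) (h' : ∀ c, ct c l ≤ ct c big) : l.Nodup := by
  rw [nd_iff] at *
  intro c
  exact (h' c).trans (h c)

end
section
variable {V : Type*} {A : V → V → Prop} {d : V → ℕ} {n m : ℕ}

theorem Ctx.no (K : Ctx A d n m) {L : List V} {a b : V} (h : Pth A a L b) (hA : A b a)
    (hN : L.Nodup) (h1 : m < L.length) (h2 : L.length < n) : False := by
  have := K.hmax L a b h hA hN h1
  omega

theorem lemmaS (K : Ctx A d n m) {z w c y y' : V} {M1 P2 : List V}
    (hM1 : Pth A w M1 c) (hcz : A c z) (hzw : A z w) (hcy : A c y) (hzy : ¬ A z y)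
    (hwy : ¬ A w y ∨ m = 2) (hP : Pth A y (y :: P2) y')
    (hnd : (z :: (M1 ++ y :: P2)).Nodup) (hlen : (z :: (M1 ++ y :: P2)).length = n)
    (hlm : (z :: M1).length = m)
    (hy1 : ∀ S1 s S2, P2 = S1 ++ s :: S2 → A y s → S1 = []) : False := by
  classical
  have hmn := K.hmn
  have hm := K.hm
  simp only [List.length_cons, List.length_append] at hlen hlm
  have hyz : ¬ A y z := fun h => K.no ((hM1.snoc hcy).snoc h) hzw
    (by exact nd_of hnd fun c => by simp only [ct_append, ct_cons, ct_nil]; omega) (by simp; omega) (by simp; omega)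
  have hne : z ≠ y := by grind [List.nodup_append]
  obtain ⟨st1, st2, st3⟩ := K.star z y c hne hzy hyz hcz hcy
  have dy := K.hd y _ hnd (by simp; omega)
  have dz := K.hd z _ hnd (by simp; omega)
  rw [dl_cons, dl_append, dl_cons y y] at dy
  rw [dl_cons, dl_append, dl_cons z y] at dz
  rw [dl_nonadj hyz hzy, dl_nonadj (K.irr y) (K.irr y)] at dy
  rw [dl_nonadj hzy hyz, dl_nonadj (K.irr z) (K.irr z)] at dz
  have hNy : NI A y M1 := by
    by_contra hc
    obtain ⟨Q, hQ, hp⟩ := insert_of_not_NI hM1 hc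
    have hl := hp.length_eq
    simp at hl
    refine K.no (hQ.snoc hcz) hzw ?_ (by simp; omega) (by simp; omega)
    rw [(hp.append_right [z]).nodup_iff]
    exact nd_of hnd fun c => by simp only [ct_append, ct_cons, ct_nil]; omega
  have hyM1 := dl_NI hM1 hNy
  have outy : P2.countP (fun w => decide (A y w)) ≤ 1 := by
    cases P2 with
    | nil => simp
    | cons p P3 =>
      rw [List.countP_cons]
      have : P3.countP (fun w => decide (A y w)) = 0 := by
        rw [List.countP_eq_zero]
        intro s hs hys
        obtain ⟨S1, S2, rfl⟩ := List.append_of_mem hs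
        have := hy1 (p :: S1) s S2 (by simp) (by simpa using hys)
        simp at this
      split_ifs <;> omega
  have inz : P2.countP (fun w => decide (A w z)) ≤ 1 := by
    rcases List.eq_nil_or_concat P2 with h | ⟨P3, p, rfl⟩
    · simp [h]
    · rw [List.concat_eq_append] at *
      rw [List.countP_append]
      have : P3.countP (fun w => decide (A w z)) = 0 := by
        rw [List.countP_eq_zero]
        intro s hs hys
        simp only [decide_eq_true_eq] at hys
        obtain ⟨S1, S2, rfl⟩ := List.append_of_mem hs
        have h1 : Pth A y ((y :: S1) ++ [s]) s :=
          Pth.pre (M := S2 ++ [p]) (b := y') (by simpa using hP)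
        refine K.no ((hM1.append hcy h1).snoc hys) hzw ?_ ?_ ?_
        · exact nd_of hnd fun c => by simp only [ct_append, ct_cons, ct_nil]; omega
        · simp at *; omega
        · simp at *; omega
      have := List.countP_le_length (p := fun w => decide (A w z)) (l := [p])
      simp only [List.length_singleton] at this
      omega
  have iny := List.countP_le_length (p := fun w => decide (A w y)) (l := P2)
  by_cases hyw : A y w
  · have hNz : NI A z M1 := by
      by_contra hc
      obtain ⟨Q, hQ, hp⟩ := insert_of_not_NI hM1 hc
      have hl := hp.length_eq
      simp at hl
      refine K.no (hQ.snoc hcy) hyw ?_ (by simp; omega) (by simp; omega)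
      rw [(hp.append_right [y]).nodup_iff]
      exact nd_of hnd fun c => by simp only [ct_append, ct_cons, ct_nil]; omega
    have hzM1 := dl_NI hM1 hNz
    have hex : ∃ s ∈ P2, A z s ∧ A s y := by
      by_contra hc
      push Not at hc
      have key : ∀ l : List V, (∀ s ∈ l, A z s → ¬ A s y) →
          l.countP (fun w => decide (A z w)) + l.countP (fun w => decide (A w y)) ≤ l.length := by
        intro l
        induction l with
        | nil => simp
        | cons s l ih =>
          intro h
          have ih := ih (fun s hs => h s (by simp [hs]))
          have h1 := h s (by simp)
          simp only [List.countP_cons, decide_eq_true_eq, List.length_cons]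
          split_ifs <;> first | omega | tauto
      have := key P2 hc
      simp only [dl] at dy dz hyM1 hzM1
      omega
    obtain ⟨s, hs, hzs, hsy⟩ := hex
    exact K.no (((hM1.snoc hcz).snoc hzs).snoc hsy) hyw
      (by exact nd_of hnd fun c => by have := ct_mem c hs; simp only [ct_append, ct_cons, ct_nil]; omega) (by simp; omega) (by simp; omega)
  · have hyM1' := dl_NI' hM1 hNy hyw
    have hin : P2.countP (fun w => decide (A w y)) = P2.length := by
      simp only [dl] at dy hyM1 hyM1'
      omega
    have hdy : d y + 1 ≤ n := by
      simp only [dl] at dy hyM1 hyM1'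
      omega
    have hM1len : dl A y M1 = M1.length := by
      simp only [dl] at dy hyM1 hyM1' ⊢
      omega
    rw [List.countP_eq_length] at hin
    simp only [decide_eq_true_eq] at hin
    have hm3 : 3 ≤ m := by
      by_contra hc
      have hP2 : P2 ≠ [] := by rintro rfl; simp at hlen; omega
      have hy'P : y' ∈ P2 := by
        have := hP.2.2
        rw [List.getLast?_cons_of_ne_nil hP2] at this
        exact List.mem_of_mem_getLast? this
      refine K.no hP (hin y' hy'P) (by exact nd_of hnd fun c => by simp only [ct_append, ct_cons, ct_nil]; omega) ?_ ?_
      · simp; omega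
      · simp; omega
    have hwy : ¬ A w y := by
      rcases hwy with h | h
      · exact h
      · omega
    obtain ⟨M, rfl⟩ : ∃ M, M1 = w :: M := by
      cases M1 with
      | nil => simp at hlm; omega
      | cons x M => have := hM1.head_eq; exact ⟨M, by rw [this]⟩
    have hMne : M ≠ [] := by rintro rfl; simp at hlm; omega
    obtain ⟨w', h, hw', hwh, hM⟩ := Pth.split (L := [w]) (M := M) hM1 (by simp) hMne
    have : w' = w := by have := hw'.2.2; simpa using this.symm
    subst this
    simp only [List.length_cons] at *
    have hNyM : NI A y M := (List.isChain_append (l₁ := [w']) (l₂ := M)).1 hNy |>.2.1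
    rw [dl_cons, dl_nonadj hyw hwy] at hM1len
    have hyh : A y h := by
      by_contra hc
      have := dl_NI' hM hNyM hc
      omega
    have outz : P2.countP (fun w => decide (A z w)) = 0 := by
      rw [List.countP_eq_zero]
      intro s hs hzs
      simp only [decide_eq_true_eq] at hzs
      exact K.no (((hM.snoc hcz).snoc hzs).snoc (hin s hs)) hyh
        (by exact nd_of hnd fun c => by have := ct_mem c hs; simp only [ct_append, ct_cons, ct_nil]; omega) (by simp; omega) (by simp; omega)
    rw [dl_cons z w'] at dz
    have := dl_single_le (A := A) z w'
    have hnz : ¬ NI A z M := by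
      intro hc
      have := dl_NI hM hc
      simp only [dl] at *
      omega
    obtain ⟨Q, hQ, hp⟩ := insert_of_not_NI hM hnz
    have hl := hp.length_eq
    simp only [List.length_cons] at hl
    have hwQ : w' ∉ Q := by
      rw [hp.mem_iff]; grind [List.nodup_append]
    have hNw : NI A w' Q := by
      by_contra hc
      obtain ⟨Q', hQ', hp'⟩ := insert_of_not_NI hQ hc
      have hl' := hp'.length_eq
      simp only [List.length_cons] at hl'
      refine K.no (hQ'.snoc hcy) hyh ?_ (by simp; omega) (by simp; omega)
      rw [((hp'.trans (hp.cons w')).append_right [y]).nodup_iff]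
      exact nd_of hnd fun c => by simp only [ct_append, ct_cons, ct_nil]; omega
    have hdw : n ≤ d w' + 1 := by
      rcases walk' K hQ hNw hwQ (z := z) (by rw [hp.mem_iff]; simp) hzw with h1 | h1
      · exact h1
      · exact (K.star w' y c (by grind [List.nodup_append]) hwy hyw h1 hcy).2.1
    have hwQ' := dl_NI hQ hNw
    rw [dl_perm w' hp] at hwQ'
    have dw := K.hd w' _ hnd (by simp; omega)
    rw [dl_cons] at hwQ' dw
    rw [dl_append, dl_cons w' w', dl_cons w' y, dl_nonadj (K.irr w') (K.irr w'),
      dl_nonadj hwy hyw] at dw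
    have hz : dl A w' P2 = 0 := by
      apply dl_eq_zero
      · intro s hs hws
        exact K.no ((((hM.snoc hcz).snoc hzw).snoc hws).snoc (hin s hs)) hyh
          (by exact nd_of hnd fun c => by have := ct_mem c hs; simp only [ct_append, ct_cons, ct_nil]; omega) (by simp; omega) (by simp; omega)
      · intro s hs hsw
        obtain ⟨S1, S2, rfl⟩ := List.append_of_mem hs
        have h1 : Pth A y ((y :: S1) ++ [s]) s :=
          Pth.pre (M := S2) (b := y') (by simpa using hP)
        refine K.no ((hM.append hcy h1).snoc hsw) hwh ?_ ?_ ?_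
        · exact nd_of hnd fun c => by simp only [ct_append, ct_cons, ct_nil]; omega
        · simp at *; omega
        · simp at *; omega
    omega

theorem last_split (p : V → Prop) : ∀ M : List V, ∃ A0 B, M = A0 ++ B ∧
    (A0 = [] ∨ ∃ x A1, A0 = A1 ++ [x] ∧ p x) ∧ ∀ x ∈ B, ¬ p x := by
  intro M
  induction M with
  | nil => exact ⟨[], [], rfl, Or.inl rfl, by simp⟩
  | cons a M ih =>
    obtain ⟨A0, B, rfl, h1, h2⟩ := ih
    rcases h1 with rfl | ⟨x, A1, rfl, hx⟩
    · by_cases ha : p a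
      · exact ⟨[a], B, rfl, Or.inr ⟨a, [], rfl, ha⟩, h2⟩
      · exact ⟨[], a :: B, rfl, Or.inl rfl, by
          intro x hx
          rcases List.mem_cons.1 hx with rfl | hx
          · exact ha
          · exact h2 x (by simpa using hx)⟩
    · exact ⟨a :: (A1 ++ [x]), B, rfl, Or.inr ⟨x, a :: A1, rfl, hx⟩, h2⟩

/-- the case of gap zero -/
theorem gap_zero (K : Ctx A d n m) {a b y y' : V} {L P : List V}
    (hL : Pth A a L b) (hba : A b a) (hP : Pth A y P y') (hby : A b y) (hya : A y' a)
    (hnd : (L ++ P).Nodup) (hlm : L.length = m) : False := by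
  have hmn := K.hmn
  have hm := K.hm
  have hPne := hP.ne_nil
  have hPlen : 0 < P.length := List.length_pos_iff.2 hPne
  have hle := K.hlen _ hnd
  have hge := K.hmax _ _ _ (hL.append hby hP) hya hnd (by simp; omega)
  have hlen : (L ++ P).length = n := le_antisymm hle hge
  simp only [List.length_append] at hlen
  obtain ⟨P2, rfl⟩ : ∃ P2, P = y :: P2 := by
    cases P with
    | nil => exact absurd rfl hPne
    | cons x M => have := hP.head_eq; exact ⟨M, by rw [this]⟩
  simp only [List.length_cons] at hlen
  have hy1 : ∀ S1 s S2, P2 = S1 ++ s :: S2 → A y s → S1 = [] := by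
    rintro S1 s S2 rfl hys
    by_contra hS
    have hS : 0 < S1.length := List.length_pos_iff.2 hS
    have h1 : Pth A s (s :: S2) y' := Pth.suf (L := y :: S1) (by simpa using hP)
    refine K.no (hL.append hby (h1.cons hys)) hya ?_ ?_ ?_
    · exact nd_of hnd fun c => by simp only [ct_append, ct_cons, ct_nil]; omega
    · simp at *; omega
    · simp at *; omega
  obtain ⟨M, rfl⟩ : ∃ M, L = M ++ [b] := by
    rcases List.eq_nil_or_concat L with h | ⟨P3, p, rfl⟩
    · exact absurd h hL.ne_nil
    · rw [List.concat_eq_append] at *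
      have := hL.last_eq
      exact ⟨P3, by rw [this]⟩
  obtain ⟨A0, B0, rfl, h1, h2⟩ := last_split (fun x => A x y) M
  simp only [List.length_append, List.length_singleton] at hlm hlen
  have key : A0 ≠ [] → 2 ≤ B0.length := by
    intro hA
    rcases h1 with h1 | ⟨x, A1, rfl, hx⟩
    · exact absurd h1 hA
    · by_contra hc
      have h3 : Pth A a (A1 ++ [x]) x := Pth.pre (M := B0 ++ [b]) (b := b) (by simpa using hL)
      refine K.no (h3.append hx hP) hya ?_ ?_ ?_
      · exact nd_of hnd fun c => by simp only [ct_append, ct_cons, ct_nil]; omega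
      · simp at *; omega
      · simp at *; omega
  cases B0 with
  | nil =>
    have : A0 ≠ [] := by rintro rfl; simp at hlm; omega
    have := key this
    simp at this
  | cons z B1 =>
    have hzy : ¬ A z y := h2 z (by simp)
    by_cases hA : A0 = []
    · subst hA
      have hL' : Pth A a ([z] ++ (B1 ++ [b])) b := by simpa using hL
      obtain ⟨z', w, e1, e2, e3⟩ := hL'.split (by simp) (by simp)
      have hz' : a = z' := by
        have := e1.2.1; have := e1.2.2; simp at *; simp_all
      have hz'' : a = z := e1.head_eq
      subst hz' hz''
      refine lemmaS K (z := a) (w := w) (c := b) (y := y) (y' := y') (M1 := B1 ++ [b]) (P2 := P2)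
        e3 hba e2 hby hzy ?_ hP ?_ ?_ ?_ hy1
      · cases B1 with
        | nil => right; simp at hlm; omega
        | cons u B2 =>
          left
          have := e3.head_eq
          subst this
          exact h2 w (by simp)
      · simpa using hnd
      · simp at *; omega
      · simp at *; omega
    · rcases h1 with h1 | ⟨x, A1, rfl, hx⟩
      · exact absurd h1 hA
      have hB := key hA
      cases B1 with
      | nil => simp at hB
      | cons w B2 =>
        have hwy : ¬ A w y := h2 w (by simp)
        have hL' : Pth A a ((A1 ++ [x]) ++ (z :: (w :: B2 ++ [b]))) b := by simpa using hL
        obtain ⟨x', z', e1, e2, e3⟩ := hL'.split (by simp) (by simp)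
        have := e1.last_eq
        subst this
        have := e3.head_eq
        subst this
        obtain ⟨z'', w', f1, f2, f3⟩ := Pth.split (L := [z']) (M := w :: B2 ++ [b]) e3
          (by simp) (by simp)
        have : z' = z'' := by have := f1.2.2; simpa using this
        subst this
        have := f3.head_eq
        subst this
        refine lemmaS K (z := z') (w := w') (c := x') (y := y) (y' := y')
          (M1 := (w' :: B2 ++ [b]) ++ (A1 ++ [x'])) (P2 := P2)
          (f3.append hba e1) e2 f2 hx hzy (Or.inl hwy) hP ?_ ?_ ?_ hy1
        · exact nd_of hnd fun c => by simp only [ct_append, ct_cons, ct_nil]; omega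
        · simp at *; omega
        · simp at *; omega

end
section
variable {V : Type*} {A : V → V → Prop} {d : V → ℕ} {n m : ℕ}

/-- bypass configuration -/
def BP (A : V → V → Prop) (m : ℕ) (L G P : List V) : Prop :=
  ∃ a b y y', Pth A a L b ∧ Pth A y P y' ∧ A b y ∧ A y' a ∧ (L ++ G ++ P).Nodup ∧
    L.length + G.length = m ∧ ((G = [] ∧ A b a) ∨ ∃ g g', Pth A g G g' ∧ A b g ∧ A g' a)

theorem BP_left {a b g g' y y' x : V} {L G1 G2 P : List V} (hL : Pth A a L b)
    (hG : Pth A g (G1 ++ x :: G2) g') (hbg : A b g) (hga : A g' a) (hP : Pth A y P y')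
    (hby : A b y) (hyx : A y' x) (hnd : (L ++ (G1 ++ x :: G2) ++ P).Nodup)
    (hlm : L.length + (G1 ++ x :: G2).length = m) : BP A m (x :: G2 ++ L) G1 P := by
  refine ⟨x, b, y, y', hG.suf.append hga hL, hP, hby, hyx, ?_, ?_, ?_⟩
  · exact nd_of hnd fun c => by simp only [ct_append, ct_cons]; omega
  · simp at *; omega
  · by_cases h : G1 = []
    · subst h
      have := hG.head_eq
      subst this
      exact Or.inl ⟨rfl, hbg⟩
    · right
      obtain ⟨c, d, h1, h2, h3⟩ := hG.split h (by simp)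
      have := h3.head_eq
      subst this
      exact ⟨g, c, h1, hbg, h2⟩

theorem BP_right {a b g g' y y' x : V} {L G1 G2 P : List V} (hL : Pth A a L b)
    (hG : Pth A g (G1 ++ x :: G2) g') (hbg : A b g) (hga : A g' a) (hP : Pth A y P y')
    (hxy : A x y) (hya : A y' a) (hnd : (L ++ (G1 ++ x :: G2) ++ P).Nodup)
    (hlm : L.length + (G1 ++ x :: G2).length = m) : BP A m (L ++ (G1 ++ [x])) G2 P := by
  refine ⟨a, x, y, y', hL.append hbg hG.pre, hP, hxy, hya, ?_, ?_, ?_⟩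
  · exact nd_of hnd fun c => by simp only [ct_append, ct_cons, ct_nil]; omega
  · simp at *; omega
  · by_cases h : G2 = []
    · subst h
      have := hG.last_eq
      subst this
      exact Or.inl ⟨rfl, hga⟩
    · right
      have hG' : Pth A g ((G1 ++ [x]) ++ G2) g' := by simpa using hG
      obtain ⟨c, d, h1, h2, h3⟩ := hG'.split (by simp) h
      have := h1.last_eq
      subst this
      exact ⟨d, g', h3, h2, hga⟩

theorem Ctx.cover (K : Ctx A d n m) {E : List V} (h : E.Nodup) (hl : E.length = n) (v : V) :
    v ∈ E := by
  by_contra hv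
  have := K.hlen (v :: E) (by simp [h, hv])
  simp at this
  omega

theorem gap_pos (K : Ctx A d n m) {a b y y' g g' : V} {L G P R : List V}
    (hL : Pth A a L b) (hP : Pth A y P y') (hby : A b y) (hya : A y' a)
    (hG : Pth A g G g') (hbg : A b g) (hga : A g' a)
    (hnd : (L ++ G ++ P).Nodup) (hlm : L.length + G.length = m)
    (hmin : ∀ L' G' P', BP A m L' G' P' → G.length ≤ G'.length)
    (hR : (L ++ G ++ R).Nodup) (hRn : (L ++ G ++ R).length = n) : False := by
  classical
  have hmn := K.hmn
  have hm := K.hm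
  have hPR : ∀ z ∈ P, z ∈ R := by
    intro z hz
    have h1 := K.cover hR hRn z
    have h2 : z ∉ L ++ G := by
      intro h
      exact (List.nodup_append.1 hnd).2.2 z h z hz rfl
    rw [List.mem_append] at h1
    tauto
  have hyP := hP.mem_left
  have hyR := hPR y hyP
  have hRn' := hRn
  simp only [List.length_append] at hRn'
  have n1 : ∀ G1 x G2, G = G1 ++ x :: G2 → ¬ A y x := by
    rintro G1 x G2 rfl h
    have := hmin _ _ _ (BP_left hL hG hbg hga (Pth.single y) hby h
      (nd_of hnd fun c => by
        have := ct_mem c hyP; simp only [ct_append, ct_cons, ct_nil]; omega) hlm)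
    simp at this
  have n2 : ∀ G1 x G2, G = G1 ++ x :: G2 → ¬ A x y := by
    rintro G1 x G2 rfl h
    have := hmin _ _ _ (BP_right hL hG hbg hga hP h hya hnd hlm)
    simp at this
    omega
  have n3 : ∀ G1 x G2, G = G1 ++ x :: G2 → ∀ z ∈ R, ¬ (A y z ∧ A z x) := by
    rintro G1 x G2 rfl z hz ⟨h1, h2⟩
    have hyz : y ≠ z := by rintro rfl; exact K.irr _ h1
    have := hmin _ _ _ (BP_left hL hG hbg hga ((Pth.single y).snoc h1) hby h2
      (by
        obtain ⟨k1, k2, k3⟩ := List.nodup_append.1 hR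
        rw [List.nodup_append]
        refine ⟨k1, by simp [hyz], ?_⟩
        intro c hc e he
        apply k3 c hc
        simp at he
        rcases he with rfl | rfl <;> assumption) hlm)
    simp at this
  have n4 : ∀ G1 x G2, G = G1 ++ x :: G2 → ∀ z ∈ R, ¬ (A x z ∧ A z y) := by
    rintro G1 x G2 rfl z hz ⟨h1, h2⟩
    have : ∃ P', Pth A z P' y' ∧ (L ++ (G1 ++ x :: G2) ++ P').Nodup := by
      by_cases hzP : z ∈ P
      · obtain ⟨P1, P2, rfl⟩ := List.append_of_mem hzP
        exact ⟨_, hP.suf, nd_of hnd fun c => by simp only [ct_append]; omega⟩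
      · refine ⟨_, hP.cons h2, ?_⟩
        obtain ⟨k1, k2, k3⟩ := List.nodup_append.1 hR
        obtain ⟨l1, l2, l3⟩ := List.nodup_append.1 hnd
        rw [List.nodup_append]
        refine ⟨k1, by simp [l2, hzP], ?_⟩
        intro c hc e he
        apply k3 c hc
        simp at he
        rcases he with rfl | he
        · exact hz
        · exact hPR _ he
    obtain ⟨P', q1, q2⟩ := this
    have := hmin _ _ _ (BP_right hL hG hbg hga q1 h1 hya q2 hlm)
    simp at this
    omega
  have hGne := hG.ne_nil
  have hGpos : 0 < G.length := List.length_pos_iff.2 hGne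
  have hyne : ∀ x ∈ L ++ G, x ≠ y := fun x hx => (List.nodup_append.1 hR).2.2 x hx y hyR
  have hNy : NI A y L := by
    by_contra hc
    obtain ⟨Q, hQ, hp⟩ := insert_of_not_NI hL hc
    have hl := hp.length_eq
    simp at hl
    refine K.no (hQ.append hbg hG) hga ?_ (by simp; omega) (by simp; omega)
    rw [(hp.append_right G).nodup_iff]
    exact nd_of hnd fun c => by
      have := ct_mem c hyP; simp only [ct_append, ct_cons]; omega
  have hyL := dl_NI hL hNy
  have hyG : dl A y G = 0 := by
    apply dl_eq_zero
    · intro w hw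
      obtain ⟨G1, G2, e⟩ := List.append_of_mem hw
      exact n1 _ _ _ e
    · intro w hw
      obtain ⟨G1, G2, e⟩ := List.append_of_mem hw
      exact n2 _ _ _ e
  have dy := K.hd y _ hR hRn
  rw [dl_append, dl_append, hyG] at dy
  have hdy : n ≤ d y + 1 := by
    obtain ⟨G1, G2, e⟩ := List.append_of_mem hG.mem_left
    exact (K.star g y b (hyne g (by simp [hG.mem_left])) (n2 _ _ _ e) (n1 _ _ _ e) hbg hby).2.2
  have multi : ∀ G1 G2, G = G1 ++ G2 → ∃ Q, Pth A a Q b ∧ Q.Perm (L ++ G1) := by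
    intro G1
    induction G1 using List.reverseRecOn with
    | nil => intro G2 _; exact ⟨L, hL, by simp⟩
    | append_singleton G1 w ih =>
      intro G2 e
      have e' : G = G1 ++ w :: G2 := by simpa using e
      obtain ⟨Q, hQ, hp⟩ := ih _ e'
      by_cases hN : NI A w Q
      · exfalso
        have hlQ := hp.length_eq
        simp only [List.length_append] at hlQ
        have hwQ := dl_NI hQ hN
        have hwG : w ∈ G := by simp [e']
        have hwy := hyne w (by simp [hwG])
        rw [dl_perm w hp, dl_append] at hwQ
        have dw := K.hd w _ hR hRn
        have pb := pair_bound' (A := A) R K.irr hyR (n1 _ _ _ e') (n2 _ _ _ e')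
          (n3 _ _ _ e') (n4 _ _ _ e')
        have h2 := dl_le (A := A) w G2
        rw [dl_append, dl_append, e', dl_append, dl_cons w w,
          dl_nonadj (K.irr w) (K.irr w)] at dw
        have hGl : G.length = G1.length + (G2.length + 1) := by simp [e']
        rcases List.eq_nil_or_concat G1 with h0 | ⟨G0, z, h0⟩
        · subst h0
          have hgw : g = w := by
            rw [e'] at hG
            exact hG.head_eq
          subst hgw
          have st := (K.star g y b hwy (n2 _ _ _ e') (n1 _ _ _ e') hbg hby).1
          simp at *
          omega
        · rw [List.concat_eq_append] at h0
          subst h0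
          have hzw : A z w := by
            rw [e'] at hG
            obtain ⟨c, c', k1, k2, k3⟩ := hG.split (by simp) (by simp)
            have e1 := k1.last_eq
            have e2 := k3.head_eq
            subst e1 e2
            exact k2
          have hwnQ : w ∉ Q := by
            rw [hp.mem_iff]
            intro h
            have : (L ++ (G0 ++ [z]) ++ [w]).Nodup := nd_of hnd fun c => by
              rw [e']
              simp only [ct_append, ct_cons, ct_nil]; omega
            exact (List.nodup_append.1 this).2.2 w h w (by simp) rfl
          have hdw : n ≤ d w + 1 := by
            rcases walk' K hQ hN hwnQ (z := z) (by rw [hp.mem_iff]; simp) hzw with h1 | h1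
            · exact h1
            · exact (K.star w y b hwy (n2 _ _ _ e') (n1 _ _ _ e') h1 hby).2.1
          simp only [List.length_append, List.length_singleton] at *
          omega
      · obtain ⟨Q', hQ', hp'⟩ := insert_of_not_NI hQ hN
        refine ⟨Q', hQ', hp'.trans ((hp.cons w).trans ?_)⟩
        rw [← List.append_assoc]
        exact (List.perm_append_singleton _ _).symm
  obtain ⟨Q, hQ, hp⟩ := multi G [] (by simp)
  have hlQ := hp.length_eq
  simp only [List.length_append] at hlQ
  have full : ∀ P' z', Pth A y P' z' → A z' a → (L ++ G ++ P').Nodup → n ≤ m + P'.length := by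
    intro P' z' h1 h2 h3
    have h4 := List.length_pos_iff.2 h1.ne_nil
    have := K.hmax _ _ _ (hQ.append hby h1) h2
      (by rw [(hp.append_right P').nodup_iff]; exact h3) (by simp; omega)
    simp at this
    omega
  have hPlen := full P y' hP hya hnd
  have hnya : ¬ A y a := by
    intro h
    have := full [y] y (Pth.single y) h (nd_of hnd fun c => by
        have := ct_mem c hyP; simp only [ct_append, ct_cons, ct_nil]; omega)
    simp at this
    omega
  have hle := K.hlen _ hnd
  simp only [List.length_append] at hle
  have hln : (L ++ G ++ P).length = n := by simp; omega
  have dy' := K.hd y _ hnd hln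
  rw [dl_append, dl_append, hyG] at dy'
  have hyL' := dl_NI' hL hNy hnya
  obtain ⟨P2, rfl⟩ : ∃ P2, P = y :: P2 := by
    cases P with
    | nil => simp at hyP
    | cons x M => have := hP.head_eq; exact ⟨M, by rw [this]⟩
  have outy : P2.countP (fun w => decide (A y w)) ≤ 1 := by
    cases P2 with
    | nil => simp
    | cons p P3 =>
      rw [List.countP_cons]
      have : P3.countP (fun w => decide (A y w)) = 0 := by
        rw [List.countP_eq_zero]
        intro s hs hys
        simp only [decide_eq_true_eq] at hys
        obtain ⟨S1, S2, rfl⟩ := List.append_of_mem hs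
        have h1 : Pth A s (s :: S2) y' := Pth.suf (L := y :: p :: S1) (by simpa using hP)
        have := full _ _ (h1.cons hys) hya
          (nd_of hnd fun c => by simp only [ct_append, ct_cons, ct_nil]; omega)
        simp at *
        omega
      split_ifs <;> omega
  have iny := List.countP_le_length (p := fun w => decide (A w y)) (l := P2)
  rw [dl_cons, dl_nonadj (K.irr y) (K.irr y)] at dy'
  simp only [List.length_cons] at *
  have hP2 : dl A y P2 ≤ P2.length + 1 := by
    simp only [dl]; omega
  refine K.no (hL.append hby hP) hya
    (nd_of hnd fun c => by simp only [ct_append]; omega) ?_ ?_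
  · simp at *; omega
  · simp at *; omega

/-- no bypass -/
theorem no_BP [Fintype V] (K : Ctx A d n m) (hn : n = Fintype.card V) {L G P : List V}
    (h : BP A m L G P) : False := by
  classical
  have : ∀ k, ∀ L G P : List V, G.length = k → BP A m L G P → False := by
    intro k
    induction k using Nat.strong_induction_on with
    | _ k ih =>
      rintro L G P hk h
      have hmin : ∀ L' G' P', BP A m L' G' P' → G.length ≤ G'.length := by
        intro L' G' P' h'
        by_contra hc
        exact ih G'.length (by omega) L' G' P' rfl h'
      obtain ⟨a, b, y, y', hL, hP, hby, hya, hnd, hlm, hG⟩ := h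
      rcases hG with ⟨rfl, hba⟩ | ⟨g, g', hG, hbg, hga⟩
      · exact gap_zero K hL hba hP hby hya (by simpa using hnd) (by simpa using hlm)
      · have hLG : (L ++ G).Nodup := (List.nodup_append.1 hnd).1
        have hR : (L ++ G ++ (Finset.univ.filter (fun v => v ∉ L ++ G)).toList).Nodup := by
          rw [List.nodup_append]
          refine ⟨hLG, Finset.nodup_toList _, ?_⟩
          rintro u hu v hv rfl
          simp only [Finset.mem_toList, Finset.mem_filter] at hv
          exact hv.2 hu
        refine gap_pos K hL hP hby hya hG hbg hga hnd hlm hmin hR ?_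
        rw [hn, ← List.toFinset_card_of_nodup hR, ← Finset.card_univ]
        congr 1
        ext v
        simp
        tauto
  exact this _ L G P rfl h

end
section
variable {V : Type*} {A : V → V → Prop} {d : V → ℕ} {n m : ℕ}

theorem return_path {C : List V} {x y : V} (h : Relation.ReflTransGen A y x) (hx : x ∈ C) :
    y ∉ C → ∃ P y' c, Pth A y P y' ∧ P.Nodup ∧ (∀ p ∈ P, p ∉ C) ∧ A y' c ∧ c ∈ C := by
  induction h using Relation.ReflTransGen.head_induction_on with
  | refl => intro h; exact absurd hx h
  | @head y z hyz _ ih =>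
    intro hy
    by_cases hz : z ∈ C
    · exact ⟨[y], y, z, Pth.single y, by simp, by simpa using hy, hyz, hz⟩
    · obtain ⟨P, y', c, h1, h2, h3, h4, h5⟩ := ih hz
      by_cases hyP : y ∈ P
      · obtain ⟨P1, P2, rfl⟩ := List.append_of_mem hyP
        exact ⟨_, y', c, h1.suf, (List.nodup_append.1 h2).2.1,
          fun p hp => h3 p (by simp at *; tauto), h4, h5⟩
      · refine ⟨_, y', c, h1.cons hyz, by simp [h2, hyP], ?_, h4, h5⟩
        intro p hp
        rcases List.mem_cons.1 hp with rfl | hp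
        · exact hy
        · exact h3 p hp

theorem exit_arc {C : List V} {a v : V} (h : Relation.ReflTransGen A a v) (ha : a ∈ C)
    (hv : v ∉ C) : ∃ x ∈ C, ∃ y, y ∉ C ∧ A x y := by
  induction h with
  | refl => exact absurd ha hv
  | @tail b c _ hbc ih =>
    by_cases hb : b ∈ C
    · exact ⟨b, hb, c, hv, hbc⟩
    · exact ih hb

theorem exists_BP (hs : ∀ x y : V, Relation.ReflTransGen A x y) {a b v : V} {C : List V}
    (hC : Pth A a C b) (hba : A b a) (hnd : C.Nodup) (hv : v ∉ C) :
    ∃ L G P, BP A C.length L G P := by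
  obtain ⟨x, hx, y, hy, hxy⟩ := exit_arc (hs a v) hC.mem_left hv
  obtain ⟨P, y', c, h1, h2, h3, h4, h5⟩ := return_path (hs y x) hx hy
  obtain ⟨E, e, hE, hec, hp⟩ : ∃ E e, Pth A c E e ∧ A e c ∧ E.Perm C := by
    obtain ⟨C1, C2, rfl⟩ := List.append_of_mem h5
    by_cases h : C1 = []
    · subst h
      have := hC.head_eq
      subst this
      exact ⟨_, b, hC, hba, by simp⟩
    · obtain ⟨p, q, k1, k2, k3⟩ := hC.split h (by simp)
      have := k3.head_eq
      subst this
      exact ⟨_, p, k3.append hba k1, k2, List.perm_append_comm⟩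
  have hxE : x ∈ E := hp.mem_iff.2 hx
  have hEP : (E ++ P).Nodup := by
    rw [List.nodup_append]
    refine ⟨hp.nodup_iff.2 hnd, h2, ?_⟩
    rintro u hu w hw rfl
    exact h3 u hw (hp.mem_iff.1 hu)
  have hl := hp.length_eq
  obtain ⟨E1, E2, rfl⟩ := List.append_of_mem hxE
  refine ⟨E1 ++ [x], E2, P, c, x, y, y', hE.pre, h1, hxy, h4, by simpa using hEP, ?_, ?_⟩
  · simp at *; omega
  · by_cases h : E2 = []
    · subst h
      have := hE.last_eq
      subst this
      exact Or.inl ⟨rfl, hec⟩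
    · right
      have hE' : Pth A c ((E1 ++ [x]) ++ E2) e := by simpa using hE
      obtain ⟨p, q, k1, k2, k3⟩ := hE'.split (by simp) h
      have := k1.last_eq
      subst this
      exact ⟨q, e, k3, k2, hec⟩

theorem exists_max (p : ℕ → Prop) (N : ℕ) (hN : ∀ k, p k → k ≤ N) {k : ℕ} (hk : p k) :
    ∃ M, p M ∧ ∀ j, p j → j ≤ M := by
  have hb : BddAbove {k | p k} := ⟨N, fun k hk => hN k hk⟩
  exact ⟨sSup {k | p k}, Nat.sSup_mem ⟨k, hk⟩ hb, fun j hj => le_csSup hb hj⟩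

theorem exists_cycle [Fintype V] [Nonempty V] (hirr : ∀ v : V, ¬A v v)
    (h2 : ∀ v a : V, ∃ w, w ≠ a ∧ A v w) :
    ∃ a b L, Pth A a L b ∧ A b a ∧ L.Nodup ∧ 2 ≤ L.length ∧ L.length < Fintype.card V := by
  classical
  obtain ⟨v0⟩ := ‹Nonempty V›
  obtain ⟨M, ⟨a, b, L, hL, hnd, rfl⟩, hmax⟩ := exists_max
    (fun k => ∃ a b L, Pth A a L b ∧ L.Nodup ∧ L.length = k) (Fintype.card V)
    (by rintro k ⟨a, b, L, _, h, rfl⟩; exact h.length_le_card)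
    (k := 1) ⟨v0, v0, [v0], Pth.single v0, by simp, rfl⟩
  obtain ⟨w, hwa, hbw⟩ := h2 b a
  have hwL : w ∈ L := by
    by_contra hc
    have := hmax (L.length + 1) ⟨a, w, L ++ [w], hL.snoc hbw, by
      rw [List.nodup_append]
      refine ⟨hnd, by simp, ?_⟩
      rintro u hu z hz rfl
      simp at hz
      exact hc (hz ▸ hu), by simp⟩
    omega
  have hcard := hnd.length_le_card
  obtain ⟨L1, L2, rfl⟩ := List.append_of_mem hwL
  have hL1 : L1 ≠ [] := by
    rintro rfl
    exact hwa hL.head_eq.symm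
  have hL1 := List.length_pos_iff.2 hL1
  refine ⟨w, b, _, hL.suf, hbw, (List.nodup_append.1 hnd).2.1, ?_, ?_⟩
  · have : L2 ≠ [] := by
      rintro rfl
      have := hL.last_eq
      subst this
      exact hirr _ hbw
    have := List.length_pos_iff.2 this
    simp; omega
  · simp at *; omega

theorem card_eq_countP [Fintype V] (p : V → Prop) [DecidablePred p] {E : List V}
    (hE : E.Nodup) (hl : E.length = Fintype.card V) :
    Nat.card {w : V // p w} = E.countP (fun w => decide (p w)) := by
  classical
  have hu : E.toFinset = Finset.univ := by
    rw [← Finset.card_eq_iff_eq_univ, List.toFinset_card_of_nodup hE, hl]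
  rw [Nat.card_eq_fintype_card, Fintype.card_subtype, List.countP_eq_length_filter,
    ← List.toFinset_card_of_nodup (hE.filter _), List.toFinset_filter, hu]
  simp

theorem hasCycle_of {a b : V} {L : List V} (h : Pth A a L b) (hba : A b a) (hnd : L.Nodup)
    {k : ℕ} (hk : L.length = k) : HasCycle A k := by
  subst hk
  obtain ⟨h1, h2, h3⟩ := h
  cases L with
  | nil => simp at h2
  | cons x l =>
    refine ⟨fun i : Fin (l.length + 1) => (x :: l)[i.val], ?_, ?_⟩
    · intro i j hij
      exact Fin.ext ((hnd.getElem_inj_iff).1 hij)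
    · show ∀ i : Fin (l.length + 1), A ((x :: l)[i.val]) ((x :: l)[(i + 1 : Fin (l.length + 1)).val])
      intro i
      by_cases hi : i = Fin.last _
      · subst hi
        simp only [Fin.last_add_one, Fin.val_last, Fin.val_zero]
        have e1 : (x :: l)[l.length] = b := by
          rw [List.getLast?_eq_getElem?] at h3
          simp at h3
          simpa using h3
        have e2 : x = a := by simpa using h2
        rw [e1]
        simpa [e2] using hba
      · have hv : (i + 1 : Fin (l.length + 1)).val = i.val + 1 := Fin.val_add_one_of_lt (Fin.lt_last_iff_ne_last.2 hi)
        simp only [hv]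
        exact List.isChain_iff_getElem.1 h1 i.val (by rw [← hv]; exact (i+1).isLt)

theorem final [Fintype V] (A : V → V → Prop)
    (hirr : ∀ v : V, ¬A v v)
    (hn : 5 ≤ Fintype.card V)
    (hstrong : IsStrong A)
    (hsemi : MinSemiDegreeGE A 2)
    (hstar : CondStar A)
    (hnoCn1 : ¬HasCycle A (Fintype.card V - 1)) :
    HasCycle A (Fintype.card V - 2) := by
  classical
  by_contra hno
  have : Nonempty V := Fintype.card_pos_iff.1 (by omega)
  have h2 : ∀ v a : V, ∃ w, w ≠ a ∧ A v w := by
    intro v a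
    by_contra hc
    push Not at hc
    have h := (hsemi v).1
    have : Subsingleton {w : V // A v w} := ⟨fun p q => Subtype.ext (by
      have h1 : p.1 = a := by
        by_contra h
        exact hc _ h p.2
      have h2 : q.1 = a := by
        by_contra h
        exact hc _ h q.2
      rw [h1, h2])⟩
    have := Finite.card_le_one_iff_subsingleton.2 this
    unfold outDeg at h
    omega
  obtain ⟨a, b, L, hL, hba, hnd, hl2, hln⟩ := exists_cycle hirr h2
  obtain ⟨m, ⟨a, b, L, hL, hba, hnd, hl2, hln, rfl⟩, hmax⟩ := exists_max
    (fun k => ∃ a b L, Pth A a L b ∧ A b a ∧ L.Nodup ∧ 2 ≤ L.length ∧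
      L.length < Fintype.card V ∧ L.length = k) (Fintype.card V)
    (by rintro k ⟨a, b, L, _, _, h, _, _, rfl⟩; exact h.length_le_card)
    (k := L.length) ⟨a, b, L, hL, hba, hnd, hl2, hln, rfl⟩
  have c1 : L.length ≠ Fintype.card V - 1 := fun h => hnoCn1 (hasCycle_of hL hba hnd h)
  have c2 : L.length ≠ Fintype.card V - 2 := fun h => hno (hasCycle_of hL hba hnd h)
  have K : Ctx A (deg A) (Fintype.card V) L.length := by
    refine ⟨hirr, ?_, ?_, by omega, hl2, fun E hE => hE.length_le_card, ?_⟩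
    · intro x y u h1 h2 h3 h4 h5
      have := hstar x y h1 h2 h3 ⟨u, h4, h5⟩
      omega
    · intro v E hE hl
      unfold deg outDeg inDeg dl
      rw [card_eq_countP _ hE hl, card_eq_countP _ hE hl]
    · intro L' a' b' k1 k2 k3 k4
      by_contra hc
      have := hmax L'.length ⟨a', b', L', k1, k2, k3, by omega, by omega, rfl⟩
      omega
  obtain ⟨v, hv⟩ : ∃ v, v ∉ L := by
    by_contra hc
    push Not at hc
    have h1 : L.toFinset = Finset.univ := by ext v; simp [hc v]
    have h2 := List.toFinset_card_of_nodup hnd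
    rw [h1, Finset.card_univ] at h2
    omega
  obtain ⟨L', G, P, h⟩ := exists_BP hstrong hL hba hnd hv
  exact no_BP K rfl h

end

end DKAux

theorem darbinyan_karapetyan_cycle_n_sub_two {V : Type*} [Fintype V] (A : V → V → Prop)
    (hirr : ∀ v : V, ¬A v v)
    (hn : 5 ≤ Fintype.card V)
    (hstrong : IsStrong A)
    (hsemi : MinSemiDegreeGE A 2)
    (hstar : CondStar A)
    (hnoCn1 : ¬HasCycle A (Fintype.card V - 1)) :
    HasCycle A (Fintype.card V - 2) := by
  exact DKAux.final A hirr hn hstrong hsemi hstar hnoCn1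
end

section
/- Let D be a strongly connected digraph on n ≥ 5 vertices with minimum semi-degree at least 2 that satisfies condition (*) and contains no cycle of length n − 1. Let C = x₁x₂…x_{n−2}x₁ be a cycle of length n − 2 in D (indices taken modulo n − 2) and let y, z be the two vertices of D not on C. If x_i y ∈ A(D), y x_{i+2} ∈ A(D), y and x_{i+1} are non-adjacent, and d(x_{i+1}) = n, then both arcs z x_{i+1} and x_{i+1} z belong to A(D). -/
open PaperDG

theorem hasCycle_of_nat {V : Type*} (A : V → V → Prop) (N : ℕ) (hN : 2 ≤ N) (g : ℕ → V)
    (hinj : ∀ a b, a < N → b < N → g a = g b → a = b)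
    (harc : ∀ a, a + 1 < N → A (g a) (g (a + 1))) (hlast : A (g (N - 1)) (g 0)) :
    HasCycle A N := by
  have : NeZero N := ⟨by omega⟩
  have : Fact (1 < N) := ⟨by omega⟩
  refine ⟨fun j => g j.val, ?_, ?_⟩
  · intro a b hab
    exact ZMod.val_injective N (hinj _ _ (ZMod.val_lt a) (ZMod.val_lt b) hab)
  · intro j
    have hj := ZMod.val_lt j
    by_cases h : j.val + 1 < N
    · have : (j + 1).val = j.val + 1 := by
        rw [ZMod.val_add, ZMod.val_one, Nat.mod_eq_of_lt h]
      simp only [this]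
      exact harc _ h
    · have e : j.val = N - 1 := by omega
      have : (j + 1).val = 0 := by
        rw [ZMod.val_add, ZMod.val_one, e, Nat.sub_add_cancel (by omega), Nat.mod_self]
      simp only [this, e]
      exact hlast

theorem insertion_bound {V : Type*} (A : V → V → Prop) (m : ℕ) (hm : 1 ≤ m) (c : ℕ → V)
    (hinj : ∀ a b, c a = c b → a ≡ b [MOD m])
    (hper : ∀ a, c (a + m) = c a)
    (harc : ∀ a, A (c a) (c (a + 1))) (v : V) (hv : ∀ a, c a ≠ v)
    (hno : ¬ HasCycle A (m + 1)) (k : ℕ) : ¬ (A (c k) v ∧ A v (c (k + 1))) := by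
  rintro ⟨ha, hb⟩
  apply hno
  refine hasCycle_of_nat A (m + 1) (by omega) (fun j => if j = m then v else c (k + 1 + j)) ?_ ?_ ?_
  · intro a b ha hb hab
    split_ifs at hab with h1 h2 h2
    · omega
    · exact absurd hab.symm (hv _)
    · exact absurd hab (hv _)
    · have := Nat.ModEq.add_left_cancel' _ (hinj _ _ hab)
      exact Nat.ModEq.eq_of_lt_of_lt this (by omega) (by omega)
  · intro a h
    have h1 : a ≠ m := by omega
    simp only [h1, if_false]
    split_ifs with h2
    · rw [show k + 1 + a = k + m by omega, hper]
      exact ha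
    · exact harc _
  · have h1 : (0 : ℕ) ≠ m := by omega
    simp only [Nat.add_sub_cancel, if_true, h1, if_false]
    exact hb

/-- Claim 2.  The cycle `C = x₁…x_{n-2}x₁` of length `n-2` is encoded by an
`(n-2)`-periodic map `x : ℕ → V` injective on `[0, n-2)`. -/
theorem darbinyan_karapetyan_claim2 {V : Type*} [Fintype V] (A : V → V → Prop)
    (hirr : ∀ v : V, ¬A v v)
    (hn : 5 ≤ Fintype.card V)
    (hstrong : IsStrong A)
    (hsemi : MinSemiDegreeGE A 2)
    (hstar : CondStar A)
    (hnoCn1 : ¬HasCycle A (Fintype.card V - 1))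
    (x : ℕ → V)
    (hper : ∀ i : ℕ, x (i + (Fintype.card V - 2)) = x i)
    (hinjC : ∀ i j : ℕ, i < Fintype.card V - 2 → j < Fintype.card V - 2 → x i = x j → i = j)
    (hcyc : ∀ i : ℕ, A (x i) (x (i + 1)))
    (y z : V) (hyz : y ≠ z)
    (hy : ∀ i : ℕ, y ≠ x i) (hz : ∀ i : ℕ, z ≠ x i)
    (i : ℕ)
    (h1 : A (x i) y) (h2 : A y (x (i + 2)))
    (h3 : ¬A y (x (i + 1))) (h4 : ¬A (x (i + 1)) y)
    (h5 : deg A (x (i + 1)) = Fintype.card V) :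
    A z (x (i + 1)) ∧ A (x (i + 1)) z := by
  classical
  obtain ⟨m, hm⟩ : ∃ m, Fintype.card V = m + 2 := ⟨Fintype.card V - 2, by omega⟩
  have hm2 : Fintype.card V - 2 = m := by omega
  have hm1 : Fintype.card V - 1 = m + 1 := by omega
  rw [hm2] at hper hinjC
  rw [hm1] at hnoCn1
  have hm3 : 3 ≤ m := by omega
  have hmod : ∀ a, x (a % m) = x a := by
    intro a
    exact Function.Periodic.map_mod_nat hper a
  have hcongr : ∀ a b, a ≡ b [MOD m] → x a = x b := by
    intro a b h
    rw [← hmod a, ← hmod b, h]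
  have hinj' : ∀ a b, x a = x b → a ≡ b [MOD m] := by
    intro a b h
    rw [← hmod a, ← hmod b] at h
    exact hinjC _ _ (Nat.mod_lt _ (by omega)) (Nat.mod_lt _ (by omega)) h
  set v := x (i + 1) with hvdef
  let c : ℕ → V := fun j => if j ≡ i + 1 [MOD m] then y else x j
  have hc1 : ∀ j, j ≡ i + 1 [MOD m] → c j = y := fun j h => if_pos h
  have hc2 : ∀ j, ¬ j ≡ i + 1 [MOD m] → c j = x j := fun j h => if_neg h
  have hcv : ∀ a, c a ≠ v := by
    intro a
    by_cases h : a ≡ i + 1 [MOD m]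
    · rw [hc1 a h]; exact hy _
    · rw [hc2 a h]; exact fun e => h (hinj' _ _ e)
  have hcz : ∀ a, c a ≠ z := by
    intro a
    by_cases h : a ≡ i + 1 [MOD m]
    · rw [hc1 a h]; exact hyz
    · rw [hc2 a h]; exact (hz _).symm
  have hcinj : ∀ a b, c a = c b → a ≡ b [MOD m] := by
    intro a b hab
    by_cases h : a ≡ i + 1 [MOD m] <;> by_cases h' : b ≡ i + 1 [MOD m]
    · exact h.trans h'.symm
    · rw [hc1 a h, hc2 b h'] at hab; exact absurd hab (hy _)
    · rw [hc2 a h, hc1 b h'] at hab; exact absurd hab.symm (hy _)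
    · rw [hc2 a h, hc2 b h'] at hab; exact hinj' _ _ hab
  have hcper : ∀ a, c (a + m) = c a := by
    intro a
    have e : a + m ≡ a [MOD m] := by simp [Nat.ModEq]
    by_cases h : a ≡ i + 1 [MOD m]
    · rw [hc1 a h, hc1 _ (e.trans h)]
    · rw [hc2 a h, hc2 _ (fun q => h (e.symm.trans q)), hper]
  have hone : ∀ a, ¬ (a + 1 ≡ a [MOD m]) := by
    intro a h
    have h' : a + 1 ≡ a + 0 [MOD m] := h
    have := Nat.ModEq.eq_of_lt_of_lt (Nat.ModEq.add_left_cancel' _ h') (by omega) (by omega)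
    omega
  have hcarc : ∀ a, A (c a) (c (a + 1)) := by
    intro a
    by_cases h : a ≡ i + 1 [MOD m]
    · have h' : ¬ a + 1 ≡ i + 1 [MOD m] := fun q => hone a (q.trans h.symm)
      rw [hc1 a h, hc2 _ h', hcongr (a + 1) (i + 2) (h.add_right 1)]
      exact h2
    · rw [hc2 a h]
      by_cases h' : a + 1 ≡ i + 1 [MOD m]
      · rw [hc1 _ h', hcongr a i (Nat.ModEq.add_right_cancel' 1 h')]
        exact h1
      · rw [hc2 _ h']; exact hcyc a
  have hins := insertion_bound A m (by omega) c hcinj hcper hcarc v hcv hnoCn1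
  have hvz : v ≠ z := (hz _).symm
  have hinjOn : Set.InjOn c (Finset.range m : Set ℕ) := by
    intro a ha b hb hab
    simp only [Finset.coe_range, Set.mem_Iio] at ha hb
    exact Nat.ModEq.eq_of_lt_of_lt (hcinj _ _ hab) ha hb
  have hn1 : z ∉ (Finset.range m).image c := by
    simp only [Finset.mem_image, not_exists, not_and]
    exact fun a _ => hcz a
  have hn2 : v ∉ insert z ((Finset.range m).image c) := by
    simp only [Finset.mem_insert, Finset.mem_image, not_or, not_exists, not_and]
    exact ⟨hvz, fun a _ => hcv a⟩
  have huniv : (Finset.univ : Finset V) = insert v (insert z ((Finset.range m).image c)) := by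
    symm
    rw [← Finset.card_eq_iff_eq_univ, Finset.card_insert_of_notMem hn2,
      Finset.card_insert_of_notMem hn1, Finset.card_image_of_injOn hinjOn, Finset.card_range, hm]
  have hcount : ∀ P : V → Prop, ¬ P v → Nat.card {w : V // P w} =
      (if P z then 1 else 0) + ∑ k ∈ Finset.range m, (if P (c k) then 1 else 0) := by
    intro P hP
    rw [Nat.card_eq_fintype_card, Fintype.card_subtype, Finset.card_filter, huniv,
      Finset.sum_insert hn2, Finset.sum_insert hn1, Finset.sum_image hinjOn, if_neg hP, zero_add]
  have hsh : ∑ k ∈ Finset.range m, (if A v (c k) then 1 else 0) =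
      ∑ k ∈ Finset.range m, (if A v (c (k + 1)) then 1 else 0) := by
    have e1 := Finset.sum_range_succ (fun k => if A v (c k) then 1 else 0) m
    have e2 := Finset.sum_range_succ' (fun k => if A v (c k) then 1 else 0) m
    have e3 : c m = c 0 := by simpa using hcper 0
    simp only [e3] at e1 e2
    omega
  have hle : ∑ k ∈ Finset.range m, (if A v (c (k + 1)) then 1 else 0) +
      ∑ k ∈ Finset.range m, (if A (c k) v then 1 else 0) ≤ m := by
    rw [← Finset.sum_add_distrib]
    calc _ ≤ ∑ k ∈ Finset.range m, 1 := by
          apply Finset.sum_le_sum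
          intro k _
          have := hins k
          by_cases p : A (c k) v
          · have q : ¬ A v (c (k + 1)) := fun q => this ⟨p, q⟩
            rw [if_pos p, if_neg q]
          · rw [if_neg p]
            split_ifs <;> omega
      _ = m := by simp
  have ho : outDeg A v = _ := hcount (fun w => A v w) (hirr v)
  have hi : inDeg A v = _ := hcount (fun w => A w v) (hirr v)
  have h6 : outDeg A v + inDeg A v = m + 2 := h5.trans hm
  clear h5
  rw [ho, hi] at h6
  have h5 := h6
  clear h6
  beta_reduce at h5
  rw [hsh] at h5
  clear_value c
  generalize ∑ k ∈ Finset.range m, (if A v (c (k + 1)) then 1 else 0) = S at h5 hle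
  generalize ∑ k ∈ Finset.range m, (if A (c k) v then 1 else 0) = T at h5 hle
  clear hsh hcount
  by_contra hcon
  by_cases p : A z v
  · by_cases q : A v z
    · exact hcon ⟨p, q⟩
    · rw [if_pos p, if_neg q] at h5
      omega
  · rw [if_neg p] at h5
    split_ifs at h5 <;> omega
end

section
/- Let D be a strongly connected digraph on n ≥ 6 vertices with minimum semi-degree at least 2 that satisfies condition (*) and contains no cycle of length n − 1. Let C = x₁x₂…x_{n−2}x₁ be a cycle of length n − 2 in D (indices taken modulo n − 2) and let y, z be the two vertices of D not on C. If x₁ y ∈ A(D) and y and x₂ are non-adjacent, then y and x₃ are adjacent. -/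
open PaperDG

inductive Pth {V : Type*} (A : V → V → Prop) : List V → V → V → Prop
  | single (a : V) : Pth A [a] a a
  | cons (a b c : V) (l : List V) : A a b → Pth A l b c → Pth A (a :: l) a c

theorem Pth.append {V : Type*} {A : V → V → Prop} {l l' : List V} {a b c d : V}
    (h : Pth A l a b) (hbc : A b c) (h' : Pth A l' c d) : Pth A (l ++ l') a d := by
  induction h with
  | single a => exact Pth.cons _ _ _ _ hbc h'
  | cons a b c l hab _ ih => exact Pth.cons _ _ _ _ hab (ih hbc)

theorem Pth.get {V : Type*} {A : V → V → Prop} {l : List V} {a b : V}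
    (h : Pth A l a b) : ∃ hl : 0 < l.length, l[0] = a ∧ l[l.length - 1] = b ∧
      ∀ i (hi : i + 1 < l.length), A l[i] l[i+1] := by
  induction h with
  | single a => simp
  | cons a b c l hab _ ih =>
    obtain ⟨hl, h0, h1, h2⟩ := ih
    refine ⟨by simp, by simp, ?_, ?_⟩
    · rw [← h1]
      simp only [List.length_cons, Nat.add_sub_cancel]
      rw [List.getElem_cons]
      simp [hl.ne']
    · intro i hi
      cases i with
      | zero => simpa [h0] using hab
      | succ i => simpa using h2 i (by simpa using hi)

theorem Pth.hasCycle {V : Type*} {A : V → V → Prop} {l : List V} {a b : V}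
    (h : Pth A l a b) (hba : A b a) (hn : l.Nodup) {k : ℕ} (hk : l.length = k) :
    HasCycle A k := by
  obtain ⟨hl, h0, h1, h2⟩ := h.get
  subst hk
  obtain ⟨k, hk⟩ : ∃ k, l.length = k + 1 := ⟨l.length - 1, by omega⟩
  rw [hk]
  have key : ∃ f : Fin (k+1) → V, Function.Injective f ∧ ∀ i, A (f i) (f (i + 1)) := by
    refine ⟨fun i => l[i.val]'(by rw [hk]; exact i.isLt), ?_, ?_⟩
    · intro i j hij
      have := (List.Nodup.getElem_inj_iff hn).1 hij
      exact Fin.ext this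
    · intro i
      by_cases hi : i = Fin.last k
      · subst hi
        have e1 : (Fin.last k + 1 : Fin (k+1)).val = 0 := by simp
        simp only [e1, h0]
        have e2 : (Fin.last k).val = l.length - 1 := by simp [hk]
        simp only [e2, h1]
        exact hba
      · have e1 : (i + 1 : Fin (k+1)).val = i.val + 1 := by
          rw [Fin.val_add_one]; simp [hi]
        simp only [e1]
        apply h2
  exact key

def seg {V : Type*} (x : ℕ → V) (a k : ℕ) : List V := (List.range' a (k+1)).map x

theorem mem_seg {V : Type*} {x : ℕ → V} {a k : ℕ} {v : V} :
    v ∈ seg x a k ↔ ∃ i, (a ≤ i ∧ i < a + (k + 1)) ∧ x i = v := by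
  simp [seg, List.mem_range'_1]

theorem seg_length {V : Type*} {x : ℕ → V} {a k : ℕ} : (seg x a k).length = k + 1 := by
  simp [seg]

theorem seg_pth {V : Type*} {A : V → V → Prop} {x : ℕ → V}
    (hcyc : ∀ i : ℕ, A (x i) (x (i + 1))) (k : ℕ) :
    ∀ a, Pth A (seg x a k) (x a) (x (a + k)) := by
  induction k with
  | zero => intro a; exact Pth.single _
  | succ k ih =>
    intro a
    have := Pth.cons _ _ _ _ (hcyc a) (ih (a+1))
    have e : a + (k + 1) = a + 1 + k := by omega
    rw [e]
    exact this

theorem seg_nodup {V : Type*} {x : ℕ → V} {m : ℕ}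
    (hne : ∀ i j, i < j → j < i + m → x i ≠ x j) (a k : ℕ) (hk : k < m) :
    (seg x a k).Nodup := by
  unfold seg
  refine List.Nodup.map_on ?_ List.nodup_range'
  intro i hi j hj h
  rw [List.mem_range'_1] at hi hj
  rcases lt_trichotomy i j with h' | h' | h'
  · exact absurd h (hne _ _ h' (by omega))
  · exact h'
  · exact absurd h.symm (hne _ _ h' (by omega))

open Classical in
noncomputable def ee {V : Type*} (A : V → V → Prop) (u v : V) : ℕ := if A u v then 1 else 0

theorem ee_le {V : Type*} (A : V → V → Prop) (u v : V) : ee A u v ≤ 1 := by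
  unfold ee; split_ifs <;> simp

theorem ee_one {V : Type*} {A : V → V → Prop} {u v : V} (h : ee A u v ≠ 0) : A u v := by
  unfold ee at h; by_contra h'; simp [h'] at h

theorem ee_zero {V : Type*} {A : V → V → Prop} {u v : V} (h : ¬ A u v) : ee A u v = 0 := by
  simp [ee, h]

theorem ee_pair {V : Type*} {A : V → V → Prop} {u v a b : V} (h : A u v → A a b → False) :
    ee A u v + ee A a b ≤ 1 := by
  unfold ee
  split_ifs with h1 h2
  · exact (h h1 h2).elim
  all_goals simp

theorem deg_eq {V : Type*} [Fintype V] (A : V → V → Prop) (v : V) :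
    deg A v = ∑ w : V, (ee A v w + ee A w v) := by
  classical
  unfold deg outDeg inDeg ee
  rw [Finset.sum_add_distrib]
  simp only [Finset.sum_boole, Nat.cast_id]
  rw [Nat.card_eq_fintype_card, Nat.card_eq_fintype_card, Fintype.card_subtype,
    Fintype.card_subtype]

theorem tele (f g : ℕ → ℕ) (a k : ℕ) :
    ∑ j ∈ Finset.Ico a (a + k + 1), (f j + g j) =
      f a + g (a + k) + ∑ j ∈ Finset.Ico a (a + k), (g j + f (j+1)) := by
  induction k with
  | zero => simp
  | succ k ih =>
    rw [← add_assoc, Finset.sum_Ico_succ_top (by omega), ih, Finset.sum_Ico_succ_top (by omega)]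
    ring

theorem sum_le_len (f : ℕ → ℕ) (a k : ℕ) (h : ∀ j, a ≤ j → j < a + k → f j ≤ 1) :
    ∑ j ∈ Finset.Ico a (a + k), f j ≤ k := by
  calc _ ≤ ∑ j ∈ Finset.Ico a (a + k), 1 := Finset.sum_le_sum (by
        intro j hj; rw [Finset.mem_Ico] at hj; exact h j hj.1 hj.2)
    _ = k := by simp

/-- Claim 3. -/
theorem darbinyan_karapetyan_claim3 {V : Type*} [Fintype V] (A : V → V → Prop)
    (hirr : ∀ v : V, ¬A v v)
    (hn : 6 ≤ Fintype.card V)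
    (hstrong : IsStrong A)
    (hsemi : MinSemiDegreeGE A 2)
    (hstar : CondStar A)
    (hnoCn1 : ¬HasCycle A (Fintype.card V - 1))
    (x : ℕ → V)
    (hper : ∀ i : ℕ, x (i + (Fintype.card V - 2)) = x i)
    (hinjC : ∀ i j : ℕ, i < Fintype.card V - 2 → j < Fintype.card V - 2 → x i = x j → i = j)
    (hcyc : ∀ i : ℕ, A (x i) (x (i + 1)))
    (y z : V) (hyz : y ≠ z)
    (hy : ∀ i : ℕ, y ≠ x i) (hz : ∀ i : ℕ, z ≠ x i)
    (h1 : A (x 1) y)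
    (h2 : ¬A y (x 2)) (h3 : ¬A (x 2) y) :
    A y (x 3) ∨ A (x 3) y := by
  classical
  by_contra hcon
  push Not at hcon
  obtain ⟨h4, h5⟩ := hcon
  unfold CondStar at hstar
  obtain ⟨p, hp⟩ : ∃ p, Fintype.card V = p + 6 := ⟨Fintype.card V - 6, by omega⟩
  rw [hp] at hnoCn1 hper hinjC hstar
  simp only [show p + 6 - 1 = p + 5 by omega, show p + 6 - 2 = p + 4 by omega] at *
  -- windows
  have hne : ∀ i j, i < j → j < i + (p+4) → x i ≠ x j := by
    have hmod : ∀ i, x (i % (p+4)) = x i := fun i => by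
      have : Function.Periodic x (p+4) := hper
      exact this.map_mod_nat i
    intro i j hij hj h
    rw [← hmod i, ← hmod j] at h
    have := hinjC _ _ (Nat.mod_lt _ (by omega)) (Nat.mod_lt _ (by omega)) h
    have hd : (p+4) ∣ j - i := (Nat.modEq_iff_dvd' hij.le).1 this
    have := Nat.le_of_dvd (by omega) hd
    omega
  have hne' : ∀ i j, i ≠ j → j < i + (p+4) → i < j + (p+4) → x i ≠ x j := by
    intro i j hij h h'
    rcases lt_or_gt_of_ne hij with h'' | h''
    · exact hne _ _ h'' h
    · exact (hne _ _ h'' h').symm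
  have hx1 : x (4 + (p+1)) = x 1 := by rw [← hper 1]; congr 1; omega
  -- a: insertion of y
  have cyA : ∀ i, A (x i) y → A y (x (i+1)) → False := by
    intro i ha hb
    apply hnoCn1
    refine Pth.hasCycle (Pth.cons y _ _ _ hb (seg_pth hcyc (p+3) (i+1))) ?_ ?_ ?_
    · rw [show i + 1 + (p+3) = i + (p+4) by omega, hper]; exact ha
    · rw [List.nodup_cons]
      refine ⟨?_, seg_nodup hne _ _ (by omega)⟩
      rw [mem_seg]; rintro ⟨j, _, hj⟩; exact hy j hj.symm
    · simp [seg_length]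
  -- b
  have cyB : A y z → A z (x 3) → False := by
    intro ha hb
    apply hnoCn1
    refine Pth.hasCycle (Pth.cons y _ _ _ ha (Pth.cons z _ _ _ hb (seg_pth hcyc (p+2) 3)))
      ?_ ?_ ?_
    · rw [show 3 + (p+2) = 4 + (p+1) by omega, hx1]; exact h1
    · rw [List.nodup_cons, List.nodup_cons]
      refine ⟨?_, ?_, seg_nodup hne _ _ (by omega)⟩
      · rw [List.mem_cons, mem_seg]; rintro (h | ⟨j, _, hj⟩)
        · exact hyz h
        · exact hy j hj.symm
      · rw [mem_seg]; rintro ⟨j, _, hj⟩; exact hz j hj.symm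
    · simp [seg_length]
  -- c
  have cyC : A z y → A (x 2) z → A y (x 4) → False := by
    intro ha hb hc
    apply hnoCn1
    refine Pth.hasCycle (Pth.cons z _ _ _ ha (Pth.cons y _ _ _ hc (seg_pth hcyc (p+2) 4)))
      ?_ ?_ ?_
    · rw [show 4 + (p+2) = 2 + (p+4) by omega, hper]; exact hb
    · rw [List.nodup_cons, List.nodup_cons]
      refine ⟨?_, ?_, seg_nodup hne _ _ (by omega)⟩
      · rw [List.mem_cons, mem_seg]; rintro (h | ⟨j, _, hj⟩)
        · exact hyz h.symm
        · exact hz j hj.symm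
      · rw [mem_seg]; rintro ⟨j, _, hj⟩; exact hy j hj.symm
    · simp [seg_length]
  -- d
  have cyD : A y z → A z (x 2) → A (x 2) (x 4) → False := by
    intro ha hb hc
    apply hnoCn1
    refine Pth.hasCycle (Pth.cons y _ _ _ ha (Pth.cons z _ _ _ hb
      (Pth.cons (x 2) _ _ _ hc (seg_pth hcyc (p+1) 4)))) ?_ ?_ ?_
    · rw [hx1]; exact h1
    · rw [List.nodup_cons, List.nodup_cons, List.nodup_cons]
      refine ⟨?_, ?_, ?_, seg_nodup hne _ _ (by omega)⟩
      · rw [List.mem_cons, List.mem_cons, mem_seg]; rintro (h | h | ⟨j, _, hj⟩)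
        · exact hyz h
        · exact hy _ h
        · exact hy j hj.symm
      · rw [List.mem_cons, mem_seg]; rintro (h | ⟨j, _, hj⟩)
        · exact hz _ h
        · exact hz j hj.symm
      · rw [mem_seg]; rintro ⟨j, hj', hj⟩
        exact hne' _ _ (by omega) (by omega) (by omega) hj
    · simp [seg_length]
  -- e
  have cyE : ∀ a b, (a = 2 ∧ b = 3 ∨ a = 3 ∧ b = 2) → A y (x 4) → A (x a) (x b) →
      ∀ i, 4 ≤ i → i < 4 + (p+1) → A (x i) (x a) → A (x b) (x (i+1)) → False := by
    intro a b hab hy4 hb0 i hi hi' ha hb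
    obtain ⟨s, rfl⟩ : ∃ s, i = 4 + s := ⟨i - 4, by omega⟩
    obtain ⟨t, ht⟩ : ∃ t, p = s + t := ⟨p - s, by omega⟩
    apply hnoCn1
    refine Pth.hasCycle (Pth.cons y _ _ _ hy4 ((seg_pth hcyc s 4).append ha
      (Pth.cons (x a) _ _ _ hb0 (Pth.cons (x b) _ _ _ hb (seg_pth hcyc t (4+s+1)))))) ?_ ?_ ?_
    · rw [show 4 + s + 1 + t = 4 + (p+1) by omega, hx1]; exact h1
    · rw [List.nodup_cons, List.nodup_append', List.nodup_cons, List.nodup_cons]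
      refine ⟨?_, seg_nodup hne _ _ (by omega), ⟨?_, ?_, seg_nodup hne _ _ (by omega)⟩, ?_⟩
      · simp only [List.mem_append, List.mem_cons, mem_seg]
        rintro (⟨j, _, hj⟩ | h | h | ⟨j, _, hj⟩)
        · exact hy j hj.symm
        · exact hy _ h
        · exact hy _ h
        · exact hy j hj.symm
      · simp only [List.mem_cons, mem_seg]
        rintro (h | ⟨j, hj', hj⟩)
        · exact hne' _ _ (by omega) (by omega) (by omega) h
        · exact hne' _ _ (by omega) (by omega) (by omega) hj
      · simp only [mem_seg]
        rintro ⟨j, hj', hj⟩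
        exact hne' _ _ (by omega) (by omega) (by omega) hj
      · intro v hv
        simp only [List.mem_cons, mem_seg] at hv ⊢
        obtain ⟨k, hk, rfl⟩ := hv
        rintro (h | h | ⟨j, hj', hj⟩)
        · exact hne' _ _ (by omega) (by omega) (by omega) h
        · exact hne' _ _ (by omega) (by omega) (by omega) h
        · exact hne' _ _ (by omega) (by omega) (by omega) hj
    · simp [seg_length]; omega
  -- f
  have cyF : ∀ a b, (a = 2 ∧ b = 3 ∨ a = 3 ∧ b = 2) → A y (x 4) →
      ∀ i k, 4 ≤ i → i < k → k < 4 + (p+1) → A (x i) (x a) → A (x a) (x (i+1)) →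
        A (x k) (x b) → A (x b) (x (k+1)) → False := by
    intro a b hab hy4 i k hi hik hk ha ha' hb hb'
    obtain ⟨s, rfl⟩ : ∃ s, i = 4 + s := ⟨i - 4, by omega⟩
    obtain ⟨t, rfl⟩ : ∃ t, k = 4 + s + 1 + t := ⟨k - (4 + s + 1), by omega⟩
    obtain ⟨r, hr⟩ : ∃ r, p = s + 1 + t + r := ⟨p - (s + 1 + t), by omega⟩
    apply hnoCn1
    refine Pth.hasCycle (Pth.cons y _ _ _ hy4 ((seg_pth hcyc s 4).append ha
      (Pth.cons (x a) _ _ _ ha' ((seg_pth hcyc t (4+s+1)).append hb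
        (Pth.cons (x b) _ _ _ hb' (seg_pth hcyc r (4+s+1+t+1))))))) ?_ ?_ ?_
    · rw [show 4 + s + 1 + t + 1 + r = 4 + (p+1) by omega, hx1]; exact h1
    · rw [List.nodup_cons, List.nodup_append', List.nodup_cons, List.nodup_append',
        List.nodup_cons]
      refine ⟨?_, seg_nodup hne _ _ (by omega), ⟨?_, seg_nodup hne _ _ (by omega),
        ⟨?_, seg_nodup hne _ _ (by omega)⟩, ?_⟩, ?_⟩
      · simp only [List.mem_append, List.mem_cons, mem_seg]
        rintro (⟨j, _, hj⟩ | h | ⟨j, _, hj⟩ | h | ⟨j, _, hj⟩)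
        · exact hy j hj.symm
        · exact hy _ h
        · exact hy j hj.symm
        · exact hy _ h
        · exact hy j hj.symm
      · simp only [List.mem_append, List.mem_cons, mem_seg]
        rintro (⟨j, hj', hj⟩ | h | ⟨j, hj', hj⟩)
        · exact hne' _ _ (by omega) (by omega) (by omega) hj
        · exact hne' _ _ (by omega) (by omega) (by omega) h
        · exact hne' _ _ (by omega) (by omega) (by omega) hj
      · simp only [mem_seg]
        rintro ⟨j, hj', hj⟩
        exact hne' _ _ (by omega) (by omega) (by omega) hj
      · intro v hv
        simp only [List.mem_cons, mem_seg] at hv ⊢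
        obtain ⟨k, hk, rfl⟩ := hv
        rintro (h | ⟨j, hj', hj⟩)
        · exact hne' _ _ (by omega) (by omega) (by omega) h
        · exact hne' _ _ (by omega) (by omega) (by omega) hj
      · intro v hv
        simp only [List.mem_append, List.mem_cons, mem_seg] at hv ⊢
        obtain ⟨k, hk, rfl⟩ := hv
        rintro (h | ⟨j, hj', hj⟩ | h | ⟨j, hj', hj⟩)
        · exact hne' _ _ (by omega) (by omega) (by omega) h
        · exact hne' _ _ (by omega) (by omega) (by omega) hj
        · exact hne' _ _ (by omega) (by omega) (by omega) h
        · exact hne' _ _ (by omega) (by omega) (by omega) hj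
    · simp [seg_length]; omega
  -- the vertex set
  have hinjO : Set.InjOn x (Finset.Ico 2 (4 + (p+1) + 1) : Finset ℕ) := by
    intro i hi j hj h
    simp only [Finset.coe_Ico, Set.mem_Ico] at hi hj
    by_contra hij
    exact hne' _ _ hij (by omega) (by omega) h
  have hzI : z ∉ Finset.image x (Finset.Ico 2 (4 + (p+1) + 1)) := by
    rw [Finset.mem_image]; rintro ⟨j, _, hj⟩; exact hz j hj.symm
  have hyI : y ∉ insert z (Finset.image x (Finset.Ico 2 (4 + (p+1) + 1))) := by
    rw [Finset.mem_insert, Finset.mem_image]; rintro (h | ⟨j, _, hj⟩)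
    · exact hyz h
    · exact hy j hj.symm
  have huniv : insert y (insert z (Finset.image x (Finset.Ico 2 (4 + (p+1) + 1)))) =
      Finset.univ := by
    apply Finset.eq_univ_of_card
    rw [Finset.card_insert_of_notMem hyI, Finset.card_insert_of_notMem hzI,
      Finset.card_image_of_injOn hinjO, hp, Nat.card_Ico]
    omega
  have hdeg : ∀ v, deg A v = (ee A v y + ee A y v) + ((ee A v z + ee A z v) +
      ((ee A v (x 2) + ee A (x 2) v) + ((ee A v (x 3) + ee A (x 3) v) +
      (ee A v (x 4) + ee A (x 1) v +
        ∑ j ∈ Finset.Ico 4 (4 + (p+1)), (ee A (x j) v + ee A v (x (j+1))))))) := by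
    intro v
    rw [deg_eq, ← huniv, Finset.sum_insert hyI, Finset.sum_insert hzI,
      Finset.sum_image hinjO, Finset.sum_eq_sum_Ico_succ_bot (by omega),
      Finset.sum_eq_sum_Ico_succ_bot (by omega),
      tele (fun j => ee A v (x j)) (fun j => ee A (x j) v) 4 (p+1), hx1]
  have hmem : ∀ v, v = y ∨ v = z ∨ ∃ j, 2 ≤ j ∧ j ≤ 4 + (p+1) ∧ v = x j := by
    intro v
    have : v ∈ insert y (insert z (Finset.image x (Finset.Ico 2 (4 + (p+1) + 1)))) := by
      rw [huniv]; simp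
    simp only [Finset.mem_insert, Finset.mem_image, Finset.mem_Ico] at this
    rcases this with h | h | ⟨j, hj, rfl⟩
    · exact Or.inl h
    · exact Or.inr (Or.inl h)
    · exact Or.inr (Or.inr ⟨j, by omega, by omega, rfl⟩)
  -- degree of y
  obtain ⟨hs1, hs2⟩ := hstar y (x 2) (hy 2) h2 h3 ⟨x 1, h1, hcyc 1⟩
  have hdy := hdeg y
  have hsy := sum_le_len (fun j => ee A (x j) y + ee A y (x (j+1))) 4 (p+1)
    (fun j _ _ => ee_pair (cyA j))
  rw [ee_zero (hirr y), ee_zero h2, ee_zero h3, ee_zero h4, ee_zero h5] at hdy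
  have b1 := ee_le A y z
  have b2 := ee_le A z y
  have b3 := ee_le A y (x 4)
  have b4 := ee_le A (x 1) y
  have hs2a := (le_min_iff.1 hs2).1
  try simp only at hsy
  have hyz' : A y z := ee_one (by omega)
  have hzy' : A z y := ee_one (by omega)
  have hy4 : A y (x 4) := ee_one (by omega)
  have hdyv : deg A y = p + 5 := by omega
  have hz3 : ¬ A z (x 3) := cyB hyz'
  have h2z : ¬ A (x 2) z := fun h => cyC hzy' h hy4
  -- x 2 is insertable
  obtain ⟨i, hi4, hip, hi2, h2i⟩ : ∃ i, 4 ≤ i ∧ i < 4 + (p+1) ∧ A (x i) (x 2) ∧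
      A (x 2) (x (i+1)) := by
    by_contra hcon
    push Not at hcon
    have hs := sum_le_len (fun j => ee A (x j) (x 2) + ee A (x 2) (x (j+1))) 4 (p+1)
      (fun j ha hb => ee_pair (fun h h' => hcon j ha hb h h'))
    have hd := hdeg (x 2)
    rw [ee_zero (hirr (x 2)), ee_zero h2, ee_zero h3, ee_zero h2z] at hd
    have c1 := ee_le A z (x 2)
    have c2 := ee_le A (x 2) (x 3)
    have c3 := ee_le A (x 3) (x 2)
    have c4 := ee_le A (x 2) (x 4)
    have c5 := ee_le A (x 1) (x 2)
    try simp only at hs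
    exact cyD hyz' (ee_one (by omega)) (ee_one (by omega))
  -- x 3 is not insertable
  have hE := cyE 2 3 (by omega) hy4 (hcyc 2)
  have h3n : ∀ k, 4 ≤ k → k < 4 + (p+1) → A (x k) (x 3) → A (x 3) (x (k+1)) → False := by
    intro k hk hk' ha hb
    rcases lt_trichotomy i k with h | h | h
    · exact cyF 2 3 (by omega) hy4 i k hi4 h hk' hi2 h2i ha hb
    · subst h; exact hE i hk hk' hi2 hb
    · exact cyF 3 2 (by omega) hy4 k i hk h hip ha hb hi2 h2i
  -- degree of x 3
  have hd3 : deg A (x 3) ≤ p + 4 + ee A (x 1) (x 3) := by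
    have hd := hdeg (x 3)
    rw [ee_zero (hirr (x 3)), ee_zero h4, ee_zero h5, ee_zero hz3] at hd
    have c1 := ee_le A (x 3) z
    have c2 := ee_le A (x 2) (x 3)
    have c4 := ee_le A (x 3) (x 4)
    have c6 : ee A (x i) (x 3) + ee A (x 3) (x 2) ≤ 1 := ee_pair (fun h h' =>
      cyE 3 2 (by omega) hy4 h' i hi4 hip h h2i)
    have c7 : ee A (x 3) (x (i+1)) = 0 := ee_zero (fun h => hE i hi4 hip hi2 h)
    have himem : i ∈ Finset.Ico 4 (4 + (p+1)) := Finset.mem_Ico.2 ⟨hi4, hip⟩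
    rw [← Finset.add_sum_erase _ _ himem, c7] at hd
    have hs : ∑ j ∈ (Finset.Ico 4 (4 + (p+1))).erase i,
        (ee A (x j) (x 3) + ee A (x 3) (x (j+1))) ≤ p := by
      calc _ ≤ ∑ j ∈ (Finset.Ico 4 (4 + (p+1))).erase i, 1 := Finset.sum_le_sum (by
            intro j hj
            rw [Finset.mem_erase, Finset.mem_Ico] at hj
            exact ee_pair (h3n j hj.2.1 hj.2.2))
        _ = p := by
            rw [Finset.sum_const, Finset.card_erase_of_mem himem, Nat.card_Ico]
            simp
    omega
  have h13 : ¬ A (x 1) (x 3) := by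
    intro h
    have := (hstar y (x 3) (hy 3) h4 h5 ⟨x 1, h1, h⟩).1
    have := ee_le A (x 1) (x 3)
    omega
  rw [ee_zero h13] at hd3
  -- second in-neighbour of x 3
  obtain ⟨w, hw, hw2⟩ : ∃ w, A w (x 3) ∧ w ≠ x 2 := by
    by_contra hcon
    push Not at hcon
    have h := (hsemi (x 3)).2
    unfold inDeg at h
    have : Subsingleton {w : V // A w (x 3)} :=
      ⟨fun a b => Subtype.ext ((hcon _ a.2).trans (hcon _ b.2).symm)⟩
    have := Finite.card_le_one_iff_subsingleton (α := {w : V // A w (x 3)}) |>.2 this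
    omega
  obtain ⟨k, hk, hkp, hk3⟩ : ∃ k, 4 ≤ k ∧ k ≤ 4 + (p+1) ∧ A (x k) (x 3) := by
    rcases hmem w with rfl | rfl | ⟨j, hj, hj', rfl⟩
    · exact (h4 hw).elim
    · exact (hz3 hw).elim
    · have e2 : j ≠ 2 := by rintro rfl; exact hw2 rfl
      have e3 : j ≠ 3 := by rintro rfl; exact hirr _ hw
      exact ⟨j, by omega, hj', hw⟩
  have hstep : ∀ t, k + t ≤ 4 + (p+1) → A (x (k+t)) (x 3) := by
    intro t
    induction t with
    | zero => intro _; exact hk3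
    | succ t ih =>
      intro ht
      have ha := ih (by omega)
      by_contra hb
      have hc : ¬ A (x 3) (x (k + t + 1)) := h3n (k+t) (by omega) (by omega) ha
      have := (hstar (x 3) (x (k+t+1)) (hne' _ _ (by omega) (by omega) (by omega)) hc hb
        ⟨x (k+t), ha, hcyc _⟩).2
      have := (le_min_iff.1 this).1
      omega
  have := hstep (4 + (p+1) - k) (by omega)
  rw [show k + (4 + (p+1) - k) = 4 + (p+1) by omega, hx1] at this
  exact h13 this
end

section
/- Let D be a strongly connected digraph on n ≥ 5 vertices with minimum semi-degree at least 2 that satisfies condition (*) and contains no cycle of length n − 1. Let C = x₁x₂…x_{n−2}x₁ be a cycle of length n − 2 in D (indices taken modulo n − 2) and let y, z be the two vertices of D not on C. Then for every i, at most one of the arcs x_i y and x_{i+1} y belongs to A(D). -/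
open PaperDG

set_option linter.unusedSectionVars false

namespace DK4

open PaperDG Classical

variable {V : Type*} [Fintype V]

structure Ctx (A : V → V → Prop) (m : ℕ) : Prop where
  hm : 3 ≤ m
  card : Fintype.card V = m + 2
  irr : ∀ v, ¬A v v
  semi : MinSemiDegreeGE A 2
  star : CondStar A
  noc : ¬HasCycle A (m + 1)

structure Cyc (A : V → V → Prop) (m : ℕ) (x : ZMod m → V) (y z : V) : Prop where
  inj : Function.Injective x
  arc : ∀ i, A (x i) (x (i + 1))
  yz : y ≠ z
  hy : ∀ i, y ≠ x i
  hz : ∀ i, z ≠ x i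

variable {A : V → V → Prop} {m : ℕ} {x : ZMod m → V} {y z : V}

theorem Cyc.symm (h : Cyc A m x y z) : Cyc A m x z y :=
  ⟨h.inj, h.arc, h.yz.symm, h.hz, h.hy⟩

theorem mkCycle (A : V → V → Prop) (k : ℕ) (g : ℕ → V)
    (hinj : ∀ i j, i ≤ k → j ≤ k → g i = g j → i = j)
    (harc : ∀ i, i < k → A (g i) (g (i + 1))) (hlast : A (g k) (g 0)) :
    HasCycle A (k + 1) := by
  refine ⟨fun i => g i.val, ?_, ?_⟩
  · intro i j hij
    apply ZMod.val_injective (k + 1)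
    exact hinj _ _ (Nat.lt_succ_iff.1 (ZMod.val_lt i)) (Nat.lt_succ_iff.1 (ZMod.val_lt j)) hij
  · intro i
    have hi := ZMod.val_lt i
    rcases Nat.lt_or_ge i.val k with hk | hk
    · have : (i + 1).val = i.val + 1 := by
        rw [ZMod.val_add_of_lt]
        · rw [ZMod.val_one'']; omega
        · rw [ZMod.val_one'']
          · omega
          · omega
      show A (g i.val) (g (i+1).val)
      rw [this]; exact harc _ hk
    · have hk' : i.val = k := by omega
      have : i + 1 = 0 := by
        rw [← ZMod.natCast_zmod_val i, hk']
        exact_mod_cast ZMod.natCast_self (k+1)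
      show A (g i.val) (g (i+1).val)
      rw [this, hk', ZMod.val_zero]; exact hlast

theorem cast_inj' (m : ℕ) (c : ZMod m) {i j : ℕ} (hi : i < m) (hj : j < m)
    (h : c + (i : ZMod m) = c + (j : ZMod m)) : i = j := by
  have h' : (i : ZMod m) = (j : ZMod m) := add_left_cancel h
  rw [ZMod.natCast_eq_natCast_iff'] at h'
  rwa [Nat.mod_eq_of_lt hi, Nat.mod_eq_of_lt hj] at h'

theorem F1 (G : Ctx A m) (h : Cyc A m x y z) (i j : ZMod m) (hj : j = i + 1)
    (h1 : A (x i) y) (h2 : A y (x j)) : False := by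
  subst hj
  have hm := G.hm
  apply G.noc
  refine mkCycle A m (fun k => if k < m then x (i + 1 + (k : ZMod m)) else y) ?_ ?_ ?_
  · intro a b ha hb hab
    split_ifs at hab with c1 c2 c2
    · exact cast_inj' m _ c1 c2 (h.inj hab)
    · exact absurd hab.symm (h.hy _)
    · exact absurd hab (h.hy _)
    · omega
  · intro k hk
    rw [if_pos hk]
    split_ifs with c
    · have := h.arc (i + 1 + (k : ZMod m))
      push_cast
      rwa [← add_assoc]
    · have hkm : k + 1 = m := by omega
      have : i + 1 + (k : ZMod m) = i := by
        have e : ((k + 1 : ℕ) : ZMod m) = 0 := by rw [hkm]; exact ZMod.natCast_self m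
        push_cast at e
        linear_combination e
      rw [this]; exact h1
  · skip
    rw [if_neg (lt_irrefl _), if_pos (by omega)]
    simpa using h2

theorem F2 (G : Ctx A m) (h : Cyc A m x y z) (i j : ZMod m) (hj : j = i + 2)
    (h1 : A (x i) y) (h2 : A y z) (h3 : A z (x j)) : False := by
  subst hj
  have hm := G.hm
  apply G.noc
  refine mkCycle A m (fun k => if k + 1 < m then x (i + 2 + (k : ZMod m)) else
    if k + 1 = m then y else z) ?_ ?_ ?_
  · intro a b ha hb hab
    split_ifs at hab with c1 c2 c2 c3 c4 c5 c6 c7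
    all_goals first
      | omega
      | exact cast_inj' m _ (by omega) (by omega) (h.inj hab)
      | exact absurd hab.symm (h.hy _)
      | exact absurd hab (h.hy _)
      | exact absurd hab.symm (h.hz _)
      | exact absurd hab (h.hz _)
      | exact absurd hab h.yz
      | exact absurd hab.symm h.yz
  · intro k hk
    rcases Nat.lt_or_ge (k + 2) m with c | c
    · rw [if_pos (by omega), if_pos (by omega)]
      have := h.arc (i + 2 + (k : ZMod m))
      push_cast
      rwa [← add_assoc]
    · rcases Nat.lt_or_ge (k + 1) m with c' | c'
      · have hkm : k + 2 = m := by omega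
        rw [if_pos (by omega), if_neg (by omega), if_pos (by omega)]
        have : i + 2 + (k : ZMod m) = i := by
          have e : ((k + 2 : ℕ) : ZMod m) = 0 := by rw [hkm]; exact ZMod.natCast_self m
          push_cast at e
          linear_combination e
        rw [this]; exact h1
      · rw [if_neg (by omega), if_pos (by omega), if_neg (by omega), if_neg (by omega)]
        exact h2
  · skip
    rw [if_neg (by omega), if_neg (by omega), if_pos (by omega)]
    simpa using h3

/-- sum over all vertices -/
theorem sum_all (G : Ctx A m) [NeZero m] (h : Cyc A m x y z) (p : V → Prop) :
    Nat.card {w : V // p w} = (∑ i : ZMod m, if p (x i) then 1 else 0)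
      + (if p y then 1 else 0) + (if p z then 1 else 0) := by
  let f : Option (Option (ZMod m)) → V := fun o => match o with
    | none => z
    | some none => y
    | some (some i) => x i
  have hf : Function.Injective f := by
    rintro (_ | _ | a) (_ | _ | b) hab
    · rfl
    · exact absurd hab.symm h.yz
    · exact absurd hab (h.hz _)
    · exact absurd hab h.yz
    · rfl
    · exact absurd hab (h.hy _)
    · exact absurd hab.symm (h.hz _)
    · exact absurd hab.symm (h.hy _)
    · rw [h.inj hab]
  have hb : Function.Bijective f := by
    rw [Fintype.bijective_iff_injective_and_card]
    refine ⟨hf, ?_⟩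
    rw [Fintype.card_option, Fintype.card_option, ZMod.card, G.card]
  rw [Nat.card_eq_fintype_card, Fintype.card_subtype, Finset.card_filter,
    ← hb.sum_comp (fun v => if p v then 1 else 0), Fintype.sum_option, Fintype.sum_option]
  show (if p z then 1 else 0) + ((if p y then 1 else 0) + ∑ i : ZMod m, if p (x i) then 1 else 0) = _
  ring

theorem degeq (G : Ctx A m) [NeZero m] (h : Cyc A m x y z) :
    deg A y + (Finset.univ.filter (fun i : ZMod m => ¬A (x i) y ∧ ¬A y (x (i + 1)))).card
      = m + (if A y z then 1 else 0) + (if A z y then 1 else 0) := by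
  have e1 : outDeg A y = _ := sum_all G h (fun w => A y w)
  have e2 : inDeg A y = _ := sum_all G h (fun w => A w y)
  have e3 : (∑ i : ZMod m, if A y (x i) then 1 else 0)
      = ∑ i : ZMod m, if A y (x (i+1)) then 1 else 0 :=
    (Equiv.sum_comp (Equiv.addRight (1 : ZMod m)) (fun i => if A y (x i) then 1 else 0)).symm
  have e4 : (∑ i : ZMod m, if A y (x (i+1)) then 1 else 0)
      + (∑ i : ZMod m, if A (x i) y then 1 else 0)
      + (∑ i : ZMod m, if (¬A (x i) y ∧ ¬A y (x (i + 1))) then 1 else 0) = m := by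
    rw [← Finset.sum_add_distrib, ← Finset.sum_add_distrib]
    have : ∀ i ∈ (Finset.univ : Finset (ZMod m)), (((if A y (x (i+1)) then 1 else 0)
      + (if A (x i) y then 1 else 0))
      + (if (¬A (x i) y ∧ ¬A y (x (i + 1))) then 1 else 0)) = 1 := by
      intro i _
      have := F1 G h i (i+1) rfl
      by_cases c1 : A (x i) y <;> by_cases c2 : A y (x (i+1)) <;> simp_all
    rw [Finset.sum_congr rfl this]
    simp [ZMod.card]
  have i1 := G.irr y
  rw [if_neg i1] at e1 e2
  rw [Finset.card_filter]
  unfold deg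
  rw [e1, e2, e3]
  omega

theorem full (G : Ctx A m) [NeZero m] (h : Cyc A m x y z) (hd : m + 2 ≤ deg A y) :
    A y z ∧ A z y ∧ ∀ i, A (x i) y ∨ A y (x (i + 1)) := by
  have e := degeq G h
  by_cases c1 : A y z <;> by_cases c2 : A z y <;> simp only [c1, c2, if_true, if_false] at e
  · refine ⟨c1, c2, fun i => ?_⟩
    by_contra hc
    push Not at hc
    have : 0 < (Finset.univ.filter (fun i : ZMod m => ¬A (x i) y ∧ ¬A y (x (i + 1)))).card :=
      Finset.card_pos.2 ⟨i, by simpa using hc⟩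
    omega
  all_goals omega

theorem single (G : Ctx A m) [NeZero m] (h : Cyc A m x y z) (hd : m + 1 ≤ deg A y)
    (hs : ¬(A y z ∧ A z y)) :
    (A y z ∨ A z y) ∧ deg A y = m + 1 ∧ ∀ i, A (x i) y ∨ A y (x (i + 1)) := by
  have e := degeq G h
  have key : (Finset.univ.filter (fun i : ZMod m => ¬A (x i) y ∧ ¬A y (x (i + 1)))).card = 0 →
      ∀ i, A (x i) y ∨ A y (x (i + 1)) := by
    intro h0 i
    by_contra hc
    push Not at hc
    have : 0 < (Finset.univ.filter (fun i : ZMod m => ¬A (x i) y ∧ ¬A y (x (i + 1)))).card :=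
      Finset.card_pos.2 ⟨i, by simpa using hc⟩
    omega
  by_cases c1 : A y z <;> by_cases c2 : A z y <;> simp only [c1, c2, if_true, if_false] at e
  · exact absurd ⟨c1, c2⟩ hs
  · exact ⟨Or.inl c1, by omega, key (by omega)⟩
  · exact ⟨Or.inr c2, by omega, key (by omega)⟩
  · omega

theorem defect (G : Ctx A m) [NeZero m] (h : Cyc A m x y z) (hd : m + 1 ≤ deg A y)
    (i : ZMod m) (h1 : ¬A (x i) y) (h2 : ¬A y (x (i + 1))) :
    deg A y = m + 1 ∧ ∀ j, j ≠ i → A (x j) y ∨ A y (x (j + 1)) := by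
  have e := degeq G h
  have hle : m + (if A y z then 1 else 0) + (if A z y then 1 else 0) ≤ m + 2 := by
    split_ifs <;> omega
  have : 0 < (Finset.univ.filter (fun i : ZMod m => ¬A (x i) y ∧ ¬A y (x (i + 1)))).card :=
      Finset.card_pos.2 ⟨i, by simp [h1, h2]⟩
  refine ⟨by omega, fun j hj => ?_⟩
  by_contra hc
  push Not at hc
  have : 1 < (Finset.univ.filter (fun i : ZMod m => ¬A (x i) y ∧ ¬A y (x (i + 1)))).card :=
      Finset.one_lt_card.2 ⟨i, by simp [h1, h2], j, by simp [hc], hj.symm⟩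
  omega

theorem cyc_all [NeZero m] (P : ZMod m → Prop) (i : ZMod m) (hi : P i)
    (hs : ∀ k, P k → P (k + 1)) : ∀ j, P j := by
  have : ∀ t : ℕ, P (i + t) := by
    intro t
    induction t with
    | zero => simpa using hi
    | succ t ih => push_cast; rw [← add_assoc]; exact hs _ ih
  intro j
  have e := this (j - i).val
  rw [ZMod.natCast_zmod_val] at e
  simpa using e

theorem cyc_end [NeZero m] (P : ZMod m → Prop) (i j : ZMod m) (hi : P i) (hj : ¬P j) :
    ∃ k, P k ∧ ¬P (k + 1) := by
  by_contra hc
  push Not at hc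
  exact hj (cyc_all P i hi hc j)

theorem exOut (G : Ctx A m) [NeZero m] (h : Cyc A m x y z) : ∃ i, A y (x i) := by
  by_contra hc
  push Not at hc
  have e1 : outDeg A y = _ := sum_all G h (fun w => A y w)
  have := (G.semi y).1
  simp only [hc, G.irr y, if_false, Finset.sum_const_zero] at e1
  split_ifs at e1 <;> omega

theorem exIn (G : Ctx A m) [NeZero m] (h : Cyc A m x y z) : ∃ i, A (x i) y := by
  by_contra hc
  push Not at hc
  have e1 : inDeg A y = _ := sum_all G h (fun w => A w y)
  have := (G.semi y).2
  simp only [hc, G.irr y, if_false, Finset.sum_const_zero] at e1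
  split_ifs at e1 <;> omega

theorem exOut2 (G : Ctx A m) [NeZero m] (h : Cyc A m x y z) (hyz : ¬A y z) (k : ZMod m) :
    ∃ i, i ≠ k ∧ A y (x i) := by
  by_contra hc
  push Not at hc
  have e1 : outDeg A y = _ := sum_all G h (fun w => A y w)
  have h2 := (G.semi y).1
  have : (∑ i : ZMod m, if A y (x i) then 1 else 0) ≤ 1 := by
    rw [Finset.sum_eq_single k]
    · split_ifs <;> omega
    · intro b _ hb; rw [if_neg (hc b hb)]
    · intro hk; simp at hk
  simp only [G.irr y, hyz, if_false] at e1
  omega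

theorem notAll (G : Ctx A m) [NeZero m] (h : Cyc A m x y z) : ∃ i, ¬A (x i) y := by
  obtain ⟨j, hj⟩ := exOut G h
  exact ⟨j - 1, fun hc => F1 G h (j - 1) j (by ring) hc hj⟩

theorem runEnd (G : Ctx A m) [NeZero m] (h : Cyc A m x y z) (e f : ZMod m) (hf : f = e + 1)
    (h1 : A (x e) y) (h2 : ¬A (x f) y) :
    m + 1 ≤ deg A y ∧ m + 1 ≤ deg A (x f) ∧ 2 * m + 3 ≤ deg A y + deg A (x f) := by
  have h3 : ¬A y (x f) := fun hc => F1 G h e f hf h1 hc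
  have := G.star y (x f) (h.hy _) h3 h2 ⟨x e, h1, by rw [hf]; exact h.arc e⟩
  rw [G.card] at this
  have h4 := le_min_iff.1 this.2
  omega

theorem degGe (G : Ctx A m) [NeZero m] (h : Cyc A m x y z) : m + 1 ≤ deg A y := by
  obtain ⟨i, hi⟩ := exIn G h
  obtain ⟨j, hj⟩ := notAll G h
  obtain ⟨k, hk, hk'⟩ := cyc_end (fun i => A (x i) y) i j hi hj
  exact (runEnd G h k _ rfl hk hk').1

theorem one_ne (G : Ctx A m) : (1 : ZMod m) ≠ 0 := by
  intro h
  have := (ZMod.natCast_eq_zero_iff 1 m).1 (by exact_mod_cast h)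
  have := Nat.le_of_dvd (by norm_num) this
  have := G.hm
  omega

theorem two_ne (G : Ctx A m) : (2 : ZMod m) ≠ 0 := by
  intro h
  have := (ZMod.natCast_eq_zero_iff 2 m).1 (by exact_mod_cast h)
  have := Nat.le_of_dvd (by norm_num) this
  have := G.hm
  omega

/-- replace `x (e+1)` by `y`. -/
theorem swap (G : Ctx A m) (h : Cyc A m x y z) (e f g : ZMod m) (hf : f = e + 1) (hg : g = e + 2)
    (h1 : A (x e) y) (h2 : A y (x g)) :
    Cyc A m (Function.update x f y) (x f) z := by
  have n1 := one_ne G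
  have n2 := two_ne G
  refine ⟨?_, ?_, ?_, ?_, ?_⟩
  · intro a b hab
    by_cases ca : a = f <;> by_cases cb : b = f
    · rw [ca, cb]
    · rw [ca, Function.update_self, Function.update_of_ne cb] at hab
      exact absurd hab (h.hy _)
    · rw [cb, Function.update_self, Function.update_of_ne ca] at hab
      exact absurd hab.symm (h.hy _)
    · rw [Function.update_of_ne ca, Function.update_of_ne cb] at hab
      exact h.inj hab
  · intro i
    by_cases c1 : i = f
    · have c2 : i + 1 ≠ f := fun hc => n1 (by linear_combination hc - c1)
      rw [c1] at c2 ⊢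
      rw [Function.update_self, Function.update_of_ne c2]
      have : f + 1 = g := by rw [hf, hg]; ring
      rwa [this]
    · rw [Function.update_of_ne c1]
      by_cases c2 : i + 1 = f
      · have : i = e := by linear_combination c2 + hf
        rw [c2, Function.update_self, this]; exact h1
      · rw [Function.update_of_ne c2]; exact h.arc i
  · exact (h.hz _).symm
  · intro i
    by_cases c1 : i = f
    · rw [c1, Function.update_self]; exact (h.hy _).symm
    · rw [Function.update_of_ne c1]; exact fun hc => c1 (h.inj hc).symm
  · intro i
    by_cases c1 : i = f
    · rw [c1, Function.update_self]; exact h.yz.symm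
    · rw [Function.update_of_ne c1]; exact h.hz _

/-- replace `x (e+1), x (e+2)` by `y, z`. -/
theorem swap2 (G : Ctx A m) (h : Cyc A m x y z) (e f g k : ZMod m) (hf : f = e + 1)
    (hg : g = e + 2) (hk : k = e + 3)
    (h1 : A (x e) y) (h2 : A y z) (h3 : A z (x k)) :
    Cyc A m (Function.update (Function.update x f y) g z) (x f) (x g) := by
  have n1 := one_ne G
  have n2 := two_ne G
  have hfg : f ≠ g := fun hc => n1 (by linear_combination hf - hg - hc)
  have hv : ∀ i, (i = g ∧ Function.update (Function.update x f y) g z i = z) ∨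
      (i = f ∧ Function.update (Function.update x f y) g z i = y) ∨
      (i ≠ g ∧ i ≠ f ∧ Function.update (Function.update x f y) g z i = x i) := by
    intro i
    by_cases c1 : i = g
    · left; exact ⟨c1, by rw [c1, Function.update_self]⟩
    · by_cases c2 : i = f
      · right; left; exact ⟨c2, by rw [Function.update_of_ne c1, c2, Function.update_self]⟩
      · right; right
        exact ⟨c1, c2, by rw [Function.update_of_ne c1, Function.update_of_ne c2]⟩
  refine ⟨?_, ?_, ?_, ?_, ?_⟩
  · intro a b hab
    rcases hv a with ⟨p, q⟩ | ⟨p, q⟩ | ⟨p, p', q⟩ <;>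
    rcases hv b with ⟨r, s⟩ | ⟨r, s⟩ | ⟨r, r', s⟩ <;> rw [q, s] at hab
    · rw [p, r]
    · exact absurd hab.symm h.yz
    · exact absurd hab (h.hz _)
    · exact absurd hab h.yz
    · rw [p, r]
    · exact absurd hab (h.hy _)
    · exact absurd hab.symm (h.hz _)
    · exact absurd hab.symm (h.hy _)
    · exact h.inj hab
  · intro i
    rcases hv i with ⟨p, q⟩ | ⟨p, q⟩ | ⟨p, p', q⟩ <;>
    rcases hv (i + 1) with ⟨r, s⟩ | ⟨r, s⟩ | ⟨r, r', s⟩ <;> rw [q, s]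
    · exact absurd (by linear_combination r - p) n1
    · exact absurd (by linear_combination r - p + hf - hg) n2
    · have : i + 1 = k := by linear_combination p + hg - hk
      rwa [this]
    · exact h2
    · exact absurd (by linear_combination r - p) n1
    · exact absurd (by linear_combination p + hf - hg) r
    · exact absurd (by linear_combination r + hg - hf) p'
    · have : i = e := by linear_combination r + hf
      rwa [this]
    · exact h.arc i
  · exact fun hc => hfg (h.inj hc)
  · intro i
    rcases hv i with ⟨p, q⟩ | ⟨p, q⟩ | ⟨p, p', q⟩ <;> rw [q]
    · exact (h.hz _).symm
    · exact (h.hy _).symm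
    · exact fun hc => p' (h.inj hc).symm
  · intro i
    rcases hv i with ⟨p, q⟩ | ⟨p, q⟩ | ⟨p, p', q⟩ <;> rw [q]
    · exact (h.hz _).symm
    · exact (h.hy _).symm
    · exact fun hc => p (h.inj hc).symm

/-- the vertex replaced has large degree: consequences -/
theorem swapFull (G : Ctx A m) [NeZero m] (h : Cyc A m x y z) (e f g : ZMod m) (hf : f = e + 1)
    (hg : g = e + 2) (h1 : A (x e) y) (h2 : A y (x g)) (hd : m + 2 ≤ deg A (x f)) :
    A (x f) z ∧ A z (x f) ∧ ∀ i, A (Function.update x f y i) (x f) ∨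
      A (x f) (Function.update x f y (i + 1)) :=
  full G (swap G h e f g hf hg h1 h2) hd

theorem DA1 (G : Ctx A m) [NeZero m] (h : Cyc A m x y z) (yz : A y z) (zy : A z y)
    (c : ZMod m) (h0 : A (x c) y) (h3 : A y (x (c + 3))) :
    ¬A (x (c + 1)) z ∧ ¬A z (x (c + 1 + 1)) :=
  ⟨fun hc => F2 G h.symm (c + 1) (c + 3) (by ring) hc zy h3,
    fun hc => F2 G h c (c + 1 + 1) (by ring) h0 yz hc⟩

theorem DA (G : Ctx A m) [NeZero m] (h : Cyc A m x y z) (yz : A y z) (zy : A z y)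
    (nd : ∀ i, A (x i) y ∨ A y (x (i + 1)))
    (c : ZMod m) (h0 : A (x c) y) (h1 : A (x (c + 1)) y) (h2 : ¬A (x (c + 2)) y) : False := by
  have n1 := one_ne G
  have n2 := two_ne G
  have h3 : A y (x (c + 3)) := by
    have := (nd (c + 2)).resolve_left h2
    rwa [show c + 2 + 1 = c + 3 by ring] at this
  obtain ⟨d1, d2⟩ := DA1 G h yz zy c h0 h3
  obtain ⟨dz, ndz⟩ := defect G h.symm (degGe G h.symm) (c + 1) d1 d2
  have h4 : A (x (c + 2)) z := by
    rcases ndz (c + 2) (fun hc => n1 (by linear_combination hc)) with h4 | h4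
    · exact h4
    · exact (F2 G h (c + 1) _ (by ring) h1 yz h4).elim
  have hex : ∃ e, A (x e) z ∧ ¬A (x (e + 1)) z ∧ e ≠ c := by
    by_contra hc
    push Not at hc
    have hall := cyc_all (fun i => A (x i) z ∨ i = c + 1) (c + 2) (Or.inl h4) (by
      rintro k (hk | hk)
      · by_cases hkc : k = c
        · right; rw [hkc]
        · left
          by_contra hn
          exact hkc (hc k hk hn)
      · left; rw [hk]; rwa [show c + 1 + 1 = c + 2 by ring])
    obtain ⟨j, hj⟩ := exOut G h.symm
    rcases hall (j - 1) with hk | hk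
    · exact F1 G h.symm (j - 1) j (by ring) hk hj
    · exact d2 (by rwa [show c + 1 + 1 = j by linear_combination -hk])
  obtain ⟨e, he1, he2, he3⟩ := hex
  have hec : e ≠ c + 1 := fun hc => d1 (hc ▸ he1)
  have he4 : A z (x (e + 2)) := by
    have := (ndz (e + 1) (fun hc => he3 (by linear_combination hc))).resolve_left he2
    rwa [show e + 1 + 1 = e + 2 by ring] at this
  have hr := (runEnd G h.symm e (e + 1) rfl he1 he2).2.2
  have hs := swap G h.symm e (e + 1) (e + 2) rfl rfl he1 he4
  obtain ⟨p1, p2, p3⟩ := full G hs (by omega)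
  have q0 : A (Function.update x (e + 1) z c) y := by
    by_cases hc : c = e + 1
    · rw [hc, Function.update_self]; exact zy
    · rw [Function.update_of_ne hc]; exact h0
  have q3 : A y (Function.update x (e + 1) z (c + 3)) := by
    by_cases hc : c + 3 = e + 1
    · rw [hc, Function.update_self]; exact yz
    · rw [Function.update_of_ne hc]; exact h3
  obtain ⟨r1, r2⟩ := DA1 G hs.symm p2 p1 c q0 q3
  rcases p3 (c + 1) with r | r
  · exact r1 r
  · exact r2 r

/-- X lemma -/
theorem XL (G : Ctx A m) [NeZero m] (h : Cyc A m x y z) (yz : A y z)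
    (c : ZMod m) (h0 : A (x c) y) (h1 : A (x (c + 1)) y)
    (h3 : A y (x (c + 3))) (hd : m + 2 ≤ deg A (x (c + 2))) : False := by
  have := swapFull G h (c + 1) (c + 2) (c + 3) (by ring) (by ring) h1 h3 hd
  exact F2 G h c (c + 2) rfl h0 yz this.2.1

theorem longEnd (G : Ctx A m) [NeZero m] (h : Cyc A m x y z)
    (c : ZMod m) (h0 : A (x c) y) (h1 : A (x (c + 1)) y) :
    ∃ c, A (x c) y ∧ A (x (c + 1)) y ∧ ¬A (x (c + 2)) y := by
  obtain ⟨j, hj⟩ := notAll G h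
  obtain ⟨k, ⟨hk1, hk2⟩, hk3⟩ := cyc_end (fun i => A (x i) y ∧ A (x (i + 1)) y) c j ⟨h0, h1⟩
    (fun hc => hj hc.1)
  refine ⟨k, hk1, hk2, fun hc => hk3 ⟨hk2, ?_⟩⟩
  rwa [show k + 1 + 1 = k + 2 by ring]

theorem dbl (G : Ctx A m) [NeZero m] (h : Cyc A m x y z) (yz : A y z) (zy : A z y)
    (c : ZMod m) (h0 : A (x c) y) (h1 : A (x (c + 1)) y) : False := by
  have n1 := one_ne G
  have n2 := two_ne G
  obtain ⟨c, h0, h1, h2⟩ := longEnd G h c h0 h1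
  have dy := degGe G h
  by_cases hdy : m + 2 ≤ deg A y
  · exact DA G h yz zy (full G h hdy).2.2 c h0 h1 h2
  have big : ∀ e, A (x e) y → ¬A (x (e + 1)) y → m + 2 ≤ deg A (x (e + 1)) := by
    intro e p q
    have := (runEnd G h e (e + 1) rfl p q).2.2
    omega
  have dw : m + 2 ≤ deg A (x (c + 2)) := by
    have := big (c + 1) h1 (by rwa [show c + 1 + 1 = c + 2 by ring])
    rwa [show c + 1 + 1 = c + 2 by ring] at this
  by_cases h3 : A y (x (c + 3))
  · exact XL G h yz c h0 h1 h3 dw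
  obtain ⟨-, nd⟩ := defect G h dy (c + 2) h2 (by rwa [show c + 2 + 1 = c + 3 by ring])
  have oz2 : ¬A z (x (c + 2)) := fun hc => F2 G h c _ rfl h0 yz hc
  have oz3 : ¬A z (x (c + 3)) := fun hc => F2 G h (c + 1) _ (by ring) h1 yz hc
  have oy2 : ¬A y (x (c + 2)) := fun hc => F1 G h (c + 1) _ (by ring) h1 hc
  have dz := degGe G h.symm
  by_cases h4 : A (x (c + 3)) y
  · by_cases h5 : A (x (c + 4)) y
    · -- another long run
      have hex : ∃ e, A (x e) y ∧ A (x (e + 1)) y ∧ ¬A (x (e + 2)) y ∧ e ≠ c := by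
        by_contra hc
        push Not at hc
        have hall := cyc_all (fun i => (A (x i) y ∧ A (x (i + 1)) y) ∨ i = c + 1 ∨ i = c + 2)
          (c + 2) (Or.inr (Or.inr rfl)) (by
            rintro k (⟨hk1, hk2⟩ | hk | hk)
            · by_cases hk3 : A (x (k + 2)) y
              · left; exact ⟨hk2, by rwa [show k + 1 + 1 = k + 2 by ring]⟩
              · right; left; rw [hc k hk1 hk2 hk3]
            · right; right; rw [hk]; ring
            · left; rw [hk, show c + 2 + 1 = c + 3 by ring, show c + 3 + 1 = c + 4 by ring]
              exact ⟨h4, h5⟩)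
        obtain ⟨j, hj⟩ := exOut G h
        have hnj : ¬A (x (j - 1)) y := fun hk => F1 G h (j - 1) j (by ring) hk hj
        rcases hall (j - 1) with hk | hk | hk
        · exact hnj hk.1
        · exact hnj (hk ▸ h1)
        · exact h3 (by rwa [show c + 3 = j by linear_combination -hk])
      obtain ⟨e, e0, e1, e2, e3⟩ := hex
      refine XL G h yz e e0 e1 ?_ ?_
      · have := (nd (e + 2) (fun hc => e3 (by linear_combination hc))).resolve_left e2
        rwa [show e + 2 + 1 = e + 3 by ring] at this
      · have := big (e + 1) e1 (by rwa [show e + 1 + 1 = e + 2 by ring])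
        rwa [show e + 1 + 1 = e + 2 by ring] at this
    · -- singleton run
      have h6 : A y (x (c + 5)) := by
        have := (nd (c + 4) (fun hc => n2 (by linear_combination hc))).resolve_left h5
        rwa [show c + 4 + 1 = c + 5 by ring] at this
      have dv : m + 2 ≤ deg A (x (c + 4)) := by
        have := big (c + 3) h4 (by rwa [show c + 3 + 1 = c + 4 by ring])
        rwa [show c + 3 + 1 = c + 4 by ring] at this
      obtain ⟨v1, v2, -⟩ := swapFull G h (c + 3) (c + 4) (c + 5) (by ring) (by ring) h4 h6 dv
      have iz3 : ¬A (x (c + 3)) z := fun hc => F1 G h.symm (c + 3) (c + 4) (by ring) hc v2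
      by_cases h7 : A (x (c + 2)) z
      · have hs := swap G h.symm (c + 2) (c + 3) (c + 4) (by ring) (by ring) h7 v2
        have hr := (runEnd G h.symm (c + 2) (c + 3) (by ring) h7 iz3).2.2
        have hu : ¬ m + 2 ≤ deg A (x (c + 3)) := fun hc => h3 (full G hs hc).2.1
        obtain ⟨-, -, ndz⟩ := full G h.symm (by omega)
        have h8 : A (x (c + 1)) z := (ndz (c + 1)).resolve_right
          (by rwa [show c + 1 + 1 = c + 2 by ring])
        refine DA G h.symm zy yz ndz (c + 1) h8 ?_ ?_
        · rwa [show c + 1 + 1 = c + 2 by ring]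
        · rwa [show c + 1 + 2 = c + 3 by ring]
      · have hs := swap2 G h (c + 1) (c + 2) (c + 3) (c + 4) (by ring) (by ring) (by ring) h1 yz v2
        have ne : c + 2 ≠ c + 3 := fun hc => n1 (by linear_combination -hc)
        rcases (full G hs dw).2.2 (c + 2) with r | r
        · rw [Function.update_of_ne ne, Function.update_self] at r
          exact oy2 r
        · rw [show c + 2 + 1 = c + 3 by ring, Function.update_self] at r
          exact h7 r
  · have h5 : A y (x (c + 4)) := by
      have := (nd (c + 3) (fun hc => n1 (by linear_combination hc))).resolve_left h4
      rwa [show c + 3 + 1 = c + 4 by ring] at this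
    have iz2 : ¬A (x (c + 2)) z := fun hc => F2 G h.symm (c + 2) (c + 4) (by ring) hc zy h5
    obtain ⟨-, ndz⟩ := defect G h.symm dz (c + 2) iz2 (by rwa [show c + 2 + 1 = c + 3 by ring])
    have iz1 : A (x (c + 1)) z :=
      (ndz (c + 1) (fun hc => n1 (by linear_combination -hc))).resolve_right
        (by rwa [show c + 1 + 1 = c + 2 by ring])
    have hs := swap2 G h.symm (c + 1) (c + 2) (c + 3) (c + 4) (by ring) (by ring) (by ring) iz1 zy h5
    have ne : c + 2 ≠ c + 3 := fun hc => n1 (by linear_combination -hc)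
    rcases (full G hs dw).2.2 (c + 2) with r | r
    · rw [Function.update_of_ne ne, Function.update_self] at r
      exact oz2 r
    · rw [show c + 2 + 1 = c + 3 by ring, Function.update_self] at r
      exact h2 r

theorem S1 (G : Ctx A m) [NeZero m] (h : Cyc A m x y z) (yz : A y z)
    (c : ZMod m) (h0 : A (x c) y) (h1 : A (x (c + 1)) y) : False := by
  by_cases zy : A z y
  · exact dbl G h yz zy c h0 h1
  obtain ⟨c, h0, h1, h2⟩ := longEnd G h c h0 h1
  obtain ⟨-, dy, nd⟩ := single G h (degGe G h) (fun hc => zy hc.2)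
  refine XL G h yz c h0 h1 ?_ ?_
  · have := (nd (c + 2)).resolve_left h2
    rwa [show c + 2 + 1 = c + 3 by ring] at this
  · have := (runEnd G h (c + 1) (c + 2) (by ring) h1 h2).2.2
    omega

theorem final (G : Ctx A m) [NeZero m] (h : Cyc A m x y z)
    (c : ZMod m) (h0 : A (x c) y) (h1 : A (x (c + 1)) y) : False := by
  by_cases yz : A y z
  · exact S1 G h yz c h0 h1
  obtain ⟨zy, dy, nd⟩ := single G h (degGe G h) (fun hc => yz hc.1)
  replace zy := zy.resolve_left yz
  obtain ⟨-, dz, ndz⟩ := single G h.symm (degGe G h.symm) (fun hc => yz hc.2)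
  have R : ∀ e, A (x e) y → ¬A (x (e + 1)) y → A y (x (e + 2)) ∧ m + 2 ≤ deg A (x (e + 1)) := by
    intro e p q
    have h3 := (nd (e + 1)).resolve_left q
    rw [show e + 1 + 1 = e + 2 by ring] at h3
    have := (runEnd G h e (e + 1) rfl p q).2.2
    exact ⟨h3, by omega⟩
  have R' : ∀ e, A (x e) y → ¬A (x (e + 1)) y → A (x (e + 1)) z := fun e p q =>
    (swapFull G h e (e + 1) (e + 2) rfl rfl p (R e p q).1 (R e p q).2).1
  have S : ∀ k, A (x k) y ∨ A (x (k + 1)) y := by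
    refine cyc_all _ c (Or.inl h0) ?_
    intro k hk
    by_cases hk1 : A (x (k + 1)) y
    · exact Or.inl hk1
    · right
      have hk0 := hk.resolve_right hk1
      rcases nd (k + 1 + 1) with r | r
      · exact r
      · exact (F2 G h.symm (k + 1) _ (by ring) (R' k hk0 hk1) zy r).elim
  -- start of a long run
  obtain ⟨j0, hj0⟩ := notAll G h
  obtain ⟨g, hg1, hg2⟩ := cyc_end (fun i => ¬(A (x i) y ∧ A (x (i + 1)) y)) j0 c
    (fun hc => hj0 hc.1) (fun hc => hc ⟨h0, h1⟩)
  simp only [not_not] at hg2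
  obtain ⟨g1, g2⟩ := hg2
  have g0 : ¬A (x g) y := fun hc => hg1 ⟨hc, g1⟩
  have gm : A (x (g - 1)) y := by
    rcases S (g - 1) with r | r
    · exact r
    · rw [sub_add_cancel] at r; exact absurd r g0
  have gz : A (x g) z := by
    have := R' (g - 1) gm (by rwa [sub_add_cancel])
    rwa [sub_add_cancel] at this
  obtain ⟨j, hj1, hj2⟩ := exOut2 G h yz (g + 1)
  obtain ⟨k, rfl⟩ : ∃ k, j = k + 1 + 1 := ⟨j - 2, by ring⟩
  have hk1 : ¬A (x (k + 1)) y := fun hc => F1 G h (k + 1) _ rfl hc hj2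
  have hk0 := (S k).resolve_right hk1
  have hkg : g ≠ k + 1 := fun hc => hj1 (by rw [hc])
  have hs := swap G h k (k + 1) (k + 2) rfl rfl hk0 (R k hk0 hk1).1
  obtain ⟨w1, w2, w3⟩ := full G hs (R k hk0 hk1).2
  have t1 : A (Function.update x (k + 1) y (g + 1)) (x (k + 1)) := by
    refine (w3 (g + 1)).resolve_right (fun r => ?_)
    refine F2 G hs.symm g (g + 1 + 1) (by ring) ?_ w2 r
    rwa [Function.update_of_ne hkg]
  refine F2 G hs (g + 1) (g + 1 + 2) rfl t1 w1 ?_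
  by_cases hc : g + 1 + 2 = k + 1
  · rw [hc, Function.update_self]; exact zy
  rw [Function.update_of_ne hc]
  rcases ndz (g + 1 + 1) with r | r
  · have r2 : ¬A (x (g + 1 + 1 + 1)) z := fun hc => S1 G h.symm zy _ r hc
    have r3 := (ndz (g + 1 + 1 + 1)).resolve_left r2
    have r4 := (runEnd G h.symm (g + 1 + 1) _ rfl r r2).2.2
    have r5 := swapFull G h.symm (g + 1 + 1) (g + 1 + 1 + 1) (g + 1 + 1 + 1 + 1) rfl (by ring) r r3
      (by omega)
    exact (F1 G h (g + 1 + 1) _ rfl g2 r5.2.1).elim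
  · rwa [show g + 1 + 2 = g + 1 + 1 + 1 by ring]

end DK4


/-- Claim 4. -/
theorem darbinyan_karapetyan_claim4 {V : Type*} [Fintype V] (A : V → V → Prop)
    (hirr : ∀ v : V, ¬A v v)
    (hn : 5 ≤ Fintype.card V)
    (hstrong : IsStrong A)
    (hsemi : MinSemiDegreeGE A 2)
    (hstar : CondStar A)
    (hnoCn1 : ¬HasCycle A (Fintype.card V - 1))
    (x : ℕ → V)
    (hper : ∀ i : ℕ, x (i + (Fintype.card V - 2)) = x i)
    (hinjC : ∀ i j : ℕ, i < Fintype.card V - 2 → j < Fintype.card V - 2 → x i = x j → i = j)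
    (hcyc : ∀ i : ℕ, A (x i) (x (i + 1)))
    (y z : V) (hyz : y ≠ z)
    (hy : ∀ i : ℕ, y ≠ x i) (hz : ∀ i : ℕ, z ≠ x i) :
    ∀ i : ℕ, ¬(A (x i) y ∧ A (x (i + 1)) y) := by
  obtain ⟨m, hm⟩ : ∃ m, Fintype.card V = m + 2 := ⟨Fintype.card V - 2, by omega⟩
  have e2 : Fintype.card V - 2 = m := by omega
  have e1 : Fintype.card V - 1 = m + 1 := by omega
  rw [e2] at hper hinjC
  rw [e1] at hnoCn1
  haveI : NeZero m := ⟨by omega⟩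
  have G : DK4.Ctx A m := ⟨by omega, hm, hirr, hsemi, hstar, hnoCn1⟩
  have hmod : ∀ i : ℕ, x (i % m) = x i := by
    have aux : ∀ q r : ℕ, x (r + q * m) = x r := by
      intro q r
      induction q with
      | zero => simp
      | succ q ih => rw [Nat.succ_mul, ← add_assoc, hper, ih]
    intro i
    have := aux (i / m) (i % m)
    rw [Nat.mod_add_div'] at this
    exact this.symm
  have hval : ∀ i : ℕ, x ((i : ZMod m).val) = x i := by
    intro i
    rw [ZMod.val_natCast, hmod]
  have C : DK4.Cyc A m (fun i : ZMod m => x i.val) y z := by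
    refine ⟨?_, ?_, hyz, fun i => hy _, fun i => hz _⟩
    · intro a b hab
      exact ZMod.val_injective m (hinjC _ _ (ZMod.val_lt a) (ZMod.val_lt b) hab)
    · intro i
      have := hval (i.val + 1)
      rw [Nat.cast_add, ZMod.natCast_zmod_val, Nat.cast_one] at this
      show A (x i.val) (x (i + 1).val)
      rw [this]
      exact hcyc _
  rintro i ⟨hi1, hi2⟩
  refine DK4.final G C (i : ZMod m) ?_ ?_
  · show A (x (i : ZMod m).val) y
    rwa [hval]
  · show A (x ((i : ZMod m) + 1).val) y
    have := hval (i + 1)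
    rw [Nat.cast_add, Nat.cast_one] at this
    rwa [this]
end

section
/- Let D be a strongly connected digraph on n ≥ 5 vertices with minimum semi-degree at least 2 that satisfies condition (*) and contains no cycle of length n − 1. Let C = x₁x₂…x_{n−2}x₁ be a cycle of length n − 2 in D (indices taken modulo n − 2) and let y, z be the two vertices of D not on C. If x_i y ∈ A(D) and y and x_{i+1} are non-adjacent, then at most one of the arcs y x_{i+2} and y x_{i+3} belongs to A(D). -/
open PaperDG

namespace DK
open Classical

inductive P {V : Type*} (A : V → V → Prop) : V → V → Finset V → ℕ → Prop
  | single (a : V) : P A a a {a} 1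
  | cons (a b c : V) (S : Finset V) (k : ℕ) : A a b → a ∉ S → P A b c S k →
      P A a c (insert a S) (k + 1)

variable {V : Type*} {A : V → V → Prop}

theorem P.card {a b : V} {S : Finset V} {k : ℕ} (h : P A a b S k) : S.card = k := by
  induction h with
  | single a => simp
  | cons a b c S k hab ha hp ih => rw [Finset.card_insert_of_notMem ha, ih]

theorem P.app {a b c d : V} {S T : Finset V} {k l : ℕ} (h : P A a b S k) (h' : P A c d T l)
    (hbc : A b c) (hd : ∀ v ∈ S, v ∉ T) : P A a d (S ∪ T) (k + l) := by
  induction h with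
  | single a =>
    have := P.cons a c d T l hbc (hd a (by simp)) h'
    rw [add_comm 1 l]; rw [← Finset.insert_eq]; exact this
  | cons a b' c' S k hab ha hp ih =>
    have h2 := ih hbc (fun v hv => hd v (Finset.mem_insert_of_mem hv))
    have := P.cons a b' d (S ∪ T) (k + l) hab
      (by simp only [Finset.mem_union, not_or]; exact ⟨ha, hd a (by simp)⟩) h2
    rw [Finset.insert_union, show k + 1 + l = k + l + 1 by omega]; exact this

theorem P.snoc {a b c : V} {S : Finset V} {k : ℕ} (h : P A a b S k)
    (hbc : A b c) (hd : c ∉ S) : P A a c (insert c S) (k + 1) := by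
  have := h.app (P.single c) hbc (fun v hv => by
    simp only [Finset.mem_singleton]; rintro rfl; exact hd hv)
  rwa [Finset.union_comm, ← Finset.insert_eq] at this

theorem P.fn {a b : V} {S : Finset V} {k : ℕ} (h : P A a b S k) :
    ∃ f : ℕ → V, 1 ≤ k ∧ f 0 = a ∧ f (k - 1) = b ∧ (∀ i < k, f i ∈ S) ∧
      (∀ i < k, ∀ j < k, f i = f j → i = j) ∧ ∀ i, i + 1 < k → A (f i) (f (i + 1)) := by
  induction h with
  | single a => exact ⟨fun _ => a, by simp, rfl, rfl, by simp, by omega, by omega⟩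
  | cons a b c S k hab ha hp ih =>
    obtain ⟨f, hk, h0, h1, hS, hi, hA⟩ := ih
    refine ⟨fun i => if i = 0 then a else f (i - 1), by omega, by simp, ?_, ?_, ?_, ?_⟩
    · have : k ≠ 0 := by omega
      simp [this, h1]
    · intro i hik
      by_cases h : i = 0
      · simp [h]
      · simp only [h, if_false]; exact Finset.mem_insert_of_mem (hS _ (by omega))
    · intro i hik j hjk
      by_cases h : i = 0 <;> by_cases h' : j = 0
      · omega
      · simp only [h, h', if_true, if_false]
        intro h2; exact absurd (h2 ▸ hS (j - 1) (by omega)) ha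
      · simp only [h, h', if_true, if_false]
        intro h2; exact absurd (h2 ▸ hS (i - 1) (by omega)) ha
      · simp only [h, h', if_false]
        intro h2; have := hi _ (by omega) _ (by omega) h2; omega
    · intro i hik
      by_cases h : i = 0
      · subst h; simp [h0, hab]
      · have := hA (i - 1) (by omega)
        rw [show i - 1 + 1 = i by omega] at this
        simpa [h] using this

theorem P.cycle {a b : V} {S : Finset V} {k : ℕ} (h : P A a b S k) (hba : A b a) :
    HasCycle A k := by
  obtain ⟨f, hk, h0, h1, hS, hi, hA⟩ := h.fn
  obtain ⟨k, rfl⟩ : ∃ k', k = k' + 1 := ⟨k - 1, by omega⟩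
  refine ⟨fun i => f (Fin.val (n := k + 1) i), ?_, ?_⟩
  · intro i j hij
    exact Fin.ext (hi _ (Fin.is_lt (n := k + 1) i) _ (Fin.is_lt (n := k + 1) j) hij)
  · intro i
    change A (f (Fin.val (n := k + 1) i)) (f (Fin.val (n := k + 1) (HAdd.hAdd (α := Fin (k+1)) i 1)))
    have hl := Fin.is_lt (n := k + 1) i
    rw [Fin.val_add_one (n := k) i]
    split_ifs with h
    · have : Fin.val (n := k + 1) i = k := by
        have := congrArg Fin.val h; simpa using this
      rw [this, h0]; simp at h1; rw [h1]; exact hba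
    · apply hA
      have : Fin.val (n := k + 1) i ≠ k := fun h2 => h (Fin.ext (by simpa using h2))
      omega

noncomputable def e (A : V → V → Prop) (u v : V) : ℕ := if A u v then 1 else 0

theorem e_le (u v : V) : e A u v ≤ 1 := by unfold e; split_ifs <;> simp
theorem e_pos {u v : V} (h : A u v) : e A u v = 1 := by simp [e, h]
theorem e_neg {u v : V} (h : ¬ A u v) : e A u v = 0 := by simp [e, h]

noncomputable def dS (A : V → V → Prop) (v : V) (S : Finset V) : ℕ :=
  ∑ s ∈ S, (e A v s + e A s v)

theorem P.bound {a b v : V} {S : Finset V} {k : ℕ} (h : P A a b S k) (hv : v ∉ S)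
    (hno : ¬ P A a b (insert v S) (k + 1)) :
    dS A v S + 1 ≤ k + e A v a + e A b v := by
  induction h with
  | single a => simp [dS]
  | cons a b c S k hab ha hp ih =>
    simp only [Finset.mem_insert, not_or] at hv
    have h1 := ih hv.2 (fun hq => hno (by
      rw [Finset.insert_comm]
      exact P.cons a b c _ _ hab (by
        simp only [Finset.mem_insert, not_or]; exact ⟨fun h => hv.1 h.symm, ha⟩) hq))
    have h2 : e A a v + e A v b ≤ 1 := by
      by_cases h : A a v
      · have : ¬ A v b := fun h' => hno (by
          rw [Finset.insert_comm]
          exact P.cons a v c _ _ h (by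
            simp only [Finset.mem_insert, not_or]; exact ⟨fun h => hv.1 h.symm, ha⟩)
            (P.cons v b c _ _ h' hv.2 hp))
        rw [e_neg this]; have := e_le (A := A) a v; omega
      · rw [e_neg h]; have := e_le (A := A) v b; omega
    have h3 : dS A v (insert a S) = e A v a + e A a v + dS A v S := by
      unfold dS; rw [Finset.sum_insert ha]
    omega

theorem deg_eq [Fintype V] (v : V) : deg A v = dS A v Finset.univ := by
  unfold deg outDeg inDeg dS e
  rw [Finset.sum_add_distrib]
  simp [Nat.card_eq_fintype_card, Fintype.card_subtype]

theorem P.deg [Fintype V] {m : ℕ} (hcard : Fintype.card V = m + 2) (hirr : ∀ v, ¬ A v v)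
    (nc : ∀ a b S, P A a b S (m + 1) → ¬ A b a)
    {a b : V} {S : Finset V} (h : P A a b S m) (hba : A b a) (v t : V)
    (hv : v ∉ S) (ht : t ∉ S) (hvt : v ≠ t) :
    PaperDG.deg A v ≤ m + e A v t + e A t v ∧
    (¬ A v a → ¬ A b v → PaperDG.deg A v + 1 ≤ m + e A v t + e A t v) := by
  have h1 := h.bound hv (fun hp => nc _ _ _ hp hba)
  have h2 : e A v a + e A b v ≤ 1 := by
    by_cases h' : A b v
    · have : ¬ A v a := fun h2 => nc _ _ _ (h.snoc h' hv) h2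
      rw [e_neg this]; have := e_le (A := A) b v; omega
    · rw [e_neg h']; have := e_le (A := A) v a; omega
  have hu : (Finset.univ : Finset V) = insert v (insert t S) := by
    symm; apply Finset.eq_univ_of_card
    rw [Finset.card_insert_of_notMem (by simp [hvt, hv]), Finset.card_insert_of_notMem ht, h.card,
      hcard]
  have h3 : PaperDG.deg A v = e A v t + e A t v + dS A v S := by
    rw [deg_eq, hu]; unfold dS
    rw [Finset.sum_insert (by simp [hvt, hv]), Finset.sum_insert ht, e_neg (hirr v)]
    omega
  refine ⟨by omega, fun h4 h5 => ?_⟩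
  rw [e_neg h4, e_neg h5] at h1
  omega

theorem seg (X : ℕ → V) (m : ℕ) (hinj : ∀ i j, 2 ≤ i → i ≤ m → 2 ≤ j → j ≤ m → X i = X j → i = j)
    (hA : ∀ j, 2 ≤ j → j < m → A (X j) (X (j + 1))) (p q : ℕ) (hp : 2 ≤ p) (hpq : p ≤ q)
    (hq : q ≤ m) : P A (X p) (X q) ((Finset.Icc p q).image X) (q + 1 - p) := by
  induction q, hpq using Nat.le_induction with
  | base => simpa using P.single (A := A) (X p)
  | succ q hpq ih =>
    have := (ih (by omega)).snoc (hA q (by omega) (by omega)) (by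
      simp only [Finset.mem_image, Finset.mem_Icc, not_exists, not_and]
      intro j hj hj2
      have := hinj _ _ (by omega) (by omega) (by omega) (by omega) hj2
      omega)
    rw [← Finset.image_insert, show insert (q+1) (Finset.Icc p q) = Finset.Icc p (q+1) by
      ext; simp; omega, show q + 1 - p + 1 = q + 1 + 1 - p by omega] at this
    exact this

theorem out2 [Fintype V] {v : V} (h : 2 ≤ outDeg A v) (u : V) : ∃ t, t ≠ u ∧ A v t := by
  by_contra hc
  push Not at hc
  unfold outDeg at h
  rw [Nat.card_eq_fintype_card] at h
  obtain ⟨⟨s, hs⟩, ⟨t, ht⟩, hst⟩ := Fintype.one_lt_card_iff.1 (show 1 < _ from h)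
  apply hst
  have h1 : s = u := by by_contra h; exact hc s h hs
  have h2 : t = u := by by_contra h; exact hc t h ht
  subst h1; subst h2; rfl

theorem core [Fintype V] (m : ℕ) (hm : 3 ≤ m) (hcard : Fintype.card V = m + 2)
    (hirr : ∀ v, ¬ A v v) (hout : ∀ v, 2 ≤ outDeg A v) (hstar : CondStar A)
    (nc : ∀ a b S, P A a b S (m + 1) → ¬ A b a)
    (X : ℕ → V) (hinj : ∀ i j, 2 ≤ i → i ≤ m → 2 ≤ j → j ≤ m → X i = X j → i = j)
    (hA : ∀ j, 2 ≤ j → j < m → A (X j) (X (j + 1)))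
    (y w z : V) (hyw : y ≠ w) (hyz : y ≠ z) (hwz : w ≠ z)
    (hy : ∀ j, 2 ≤ j → j ≤ m → X j ≠ y) (hw : ∀ j, 2 ≤ j → j ≤ m → X j ≠ w)
    (hz : ∀ j, 2 ≤ j → j ≤ m → X j ≠ z)
    (hmy : A (X m) y) (hmw : A (X m) w) (hw2 : A w (X 2)) (hy2 : A y (X 2)) (hy3 : A y (X 3))
    (nyw : ¬ A y w) (nwy : ¬ A w y) : False := by
  have sg := seg X m hinj hA
  have hall : ∀ v, v = y ∨ v = w ∨ v = z ∨ ∃ j, 2 ≤ j ∧ j ≤ m ∧ X j = v := by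
    intro v
    have hu : insert y (insert w (insert z ((Finset.Icc 2 m).image X))) = Finset.univ := by
      apply Finset.eq_univ_of_card
      have := (sg 2 m (by omega) (by omega) le_rfl).card
      rw [Finset.card_insert_of_notMem, Finset.card_insert_of_notMem,
        Finset.card_insert_of_notMem, this, hcard]
      · omega
      all_goals simp only [Finset.mem_insert, Finset.mem_image, Finset.mem_Icc]; grind
    have := Finset.mem_univ v
    rw [← hu] at this
    simp only [Finset.mem_insert, Finset.mem_image, Finset.mem_Icc] at this
    grind
  have pC : P A (X 2) w (insert w ((Finset.Icc 2 m).image X)) m := by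
    have := (sg 2 m (by omega) (by omega) le_rfl).snoc hmw (by
      simp only [Finset.mem_image, Finset.mem_Icc]; (clear * - hm hinj hy hw hz hyw hyz hwz; grind))
    rwa [show m + 1 - 2 + 1 = m by omega] at this
  have pC' : P A (X 2) y (insert y ((Finset.Icc 2 m).image X)) m := by
    have := (sg 2 m (by omega) (by omega) le_rfl).snoc hmy (by
      simp only [Finset.mem_image, Finset.mem_Icc]; (clear * - hm hinj hy hw hz hyw hyz hwz; grind))
    rwa [show m + 1 - 2 + 1 = m by omega] at this
  have dy := (pC.deg hcard hirr nc hw2 y z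
    (by simp only [Finset.mem_insert, Finset.mem_image, Finset.mem_Icc]; (clear * - hm hinj hy hw hz hyw hyz hwz; grind))
    (by simp only [Finset.mem_insert, Finset.mem_image, Finset.mem_Icc]; (clear * - hm hinj hy hw hz hyw hyz hwz; grind)) hyz).1
  have dw := (pC'.deg hcard hirr nc hy2 w z
    (by simp only [Finset.mem_insert, Finset.mem_image, Finset.mem_Icc]; (clear * - hm hinj hy hw hz hyw hyz hwz; grind))
    (by simp only [Finset.mem_insert, Finset.mem_image, Finset.mem_Icc]; (clear * - hm hinj hy hw hz hyw hyz hwz; grind)) hwz).1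
  have dyw := (hstar y w hyw nyw nwy ⟨X m, hmy, hmw⟩).1
  rw [hcard] at dyw
  -- w → z → y is impossible
  have nwzy : A w z → ¬ A z y := by
    intro h1 h2
    have q := (((sg 3 m (by omega) (by omega) le_rfl).snoc hmw (by
      simp only [Finset.mem_image, Finset.mem_Icc]; (clear * - hm hinj hy hw hz hyw hyz hwz; grind))).snoc h1 (by
      simp only [Finset.mem_insert, Finset.mem_image, Finset.mem_Icc]; (clear * - hm hinj hy hw hz hyw hyz hwz; grind))).snoc h2 (by
      simp only [Finset.mem_insert, Finset.mem_image, Finset.mem_Icc]; (clear * - hm hinj hy hw hz hyw hyz hwz; grind))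
    rw [show m + 1 - 3 + 1 + 1 + 1 = m + 1 by omega] at q
    exact nc _ _ _ q hy3
  have e1 := e_le (A := A) y z
  have e2 := e_le (A := A) z y
  have e3 := e_le (A := A) w z
  have e4 := e_le (A := A) z w
  have e5 : e A w z + e A z y ≤ 1 := by
    by_cases h : A w z
    · rw [e_neg (nwzy h)]; omega
    · rw [e_neg h]; omega
  have ayz : A y z := by
    by_contra h; rw [e_neg h] at *; omega
  have azw : A z w := by
    by_contra h; rw [e_neg h] at *; omega
  have nw3 : ¬ A w (X 3) := by
    have q := (((sg 3 m (by omega) (by omega) le_rfl).snoc hmy (by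
      simp only [Finset.mem_image, Finset.mem_Icc]; (clear * - hm hinj hy hw hz hyw hyz hwz; grind))).snoc ayz (by
      simp only [Finset.mem_insert, Finset.mem_image, Finset.mem_Icc]; (clear * - hm hinj hy hw hz hyw hyz hwz; grind))).snoc azw (by
      simp only [Finset.mem_insert, Finset.mem_image, Finset.mem_Icc]; (clear * - hm hinj hy hw hz hyw hyz hwz; grind))
    rw [show m + 1 - 3 + 1 + 1 + 1 = m + 1 by omega] at q
    exact nc _ _ _ q
  have nz2 : ¬ A z (X 2) := by
    have q := ((sg 2 m (by omega) (by omega) le_rfl).snoc hmy (by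
      simp only [Finset.mem_image, Finset.mem_Icc]; (clear * - hm hinj hy hw hz hyw hyz hwz; grind))).snoc ayz (by
      simp only [Finset.mem_insert, Finset.mem_image, Finset.mem_Icc]; (clear * - hm hinj hy hw hz hyw hyz hwz; grind))
    rw [show m + 1 - 2 + 1 + 1 = m + 1 by omega] at q
    exact nc _ _ _ q
  -- equality for w
  have eqw : ∀ j, 2 ≤ j → j + 1 ≤ m → ¬ A (X j) w → A w (X (j + 1)) := by
    intro j hj hjm hn
    by_contra h
    have q := ((sg (j+1) m (by omega) (by omega) le_rfl).snoc hmy (by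
      simp only [Finset.mem_image, Finset.mem_Icc]; (clear * - hm hinj hy hw hz hyw hyz hwz hj hjm; grind))).app
        (sg 2 j (by omega) (by omega) (by omega)) hy2 (by
      simp only [Finset.mem_insert, Finset.mem_image, Finset.mem_Icc]; (clear * - hm hinj hy hw hz hyw hyz hwz hj hjm; grind))
    rw [show m + 1 - (j + 1) + 1 + (j + 1 - 2) = m by omega] at q
    have := (q.deg hcard hirr nc (hA j (by omega) (by omega)) w z
      (by simp only [Finset.mem_union, Finset.mem_insert, Finset.mem_image, Finset.mem_Icc]; (clear * - hm hinj hy hw hz hyw hyz hwz hj hjm; grind))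
      (by simp only [Finset.mem_union, Finset.mem_insert, Finset.mem_image, Finset.mem_Icc]; (clear * - hm hinj hy hw hz hyw hyz hwz hj hjm; grind))
      hwz).2 h hn
    omega
  have insw : ∀ j, 2 ≤ j → j + 1 ≤ m → A (X j) w → ¬ A w (X (j + 1)) := by
    intro j hj hjm h1 h2
    have q := (((sg 2 j (by omega) (by omega) (by omega)).snoc h1 (by
      simp only [Finset.mem_image, Finset.mem_Icc]; (clear * - hm hinj hy hw hz hyw hyz hwz hj hjm; grind))).app
        (sg (j+1) m (by omega) (by omega) le_rfl) h2 (by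
      simp only [Finset.mem_insert, Finset.mem_image, Finset.mem_Icc]; (clear * - hm hinj hy hw hz hyw hyz hwz hj hjm; grind))).snoc hmy (by
      simp only [Finset.mem_union, Finset.mem_insert, Finset.mem_image, Finset.mem_Icc]; (clear * - hm hinj hy hw hz hyw hyz hwz hj hjm; grind))
    rw [show j + 1 - 2 + 1 + (m + 1 - (j + 1)) + 1 = m + 1 by omega] at q
    exact nc _ _ _ q hy2
  have h2w : A (X 2) w := by
    by_contra h; exact nw3 (eqw 2 le_rfl (by omega) h)
  -- final
  have fin : A w z → ¬ A z (X 3) := by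
    intro h1 h3
    have n2z : ¬ A (X 2) z := by
      intro h
      have q := (((P.single (X 2)).snoc h (by
        simp only [Finset.mem_singleton]; (clear * - hm hinj hy hw hz hyw hyz hwz; grind))).app
          (sg 3 m (by omega) (by omega) le_rfl) h3 (by
        simp only [Finset.mem_singleton, Finset.mem_insert, Finset.mem_image, Finset.mem_Icc]; (clear * - hm hinj hy hw hz hyw hyz hwz; grind))).snoc hmy (by
        simp only [Finset.mem_singleton, Finset.mem_union, Finset.mem_insert, Finset.mem_image, Finset.mem_Icc]; (clear * - hm hinj hy hw hz hyw hyz hwz; grind))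
      rw [show 1 + 1 + (m + 1 - 3) + 1 = m + 1 by omega] at q
      exact nc _ _ _ q hy2
    have n2y : ¬ A (X 2) y := by
      intro h
      have q := (((P.single (X 2)).snoc h (by
        simp only [Finset.mem_singleton]; (clear * - hm hinj hy hw hz hyw hyz hwz; grind))).app
          (sg 3 m (by omega) (by omega) le_rfl) hy3 (by
        simp only [Finset.mem_singleton, Finset.mem_insert, Finset.mem_image, Finset.mem_Icc]; (clear * - hm hinj hy hw hz hyw hyz hwz; grind))).snoc hmw (by
        simp only [Finset.mem_singleton, Finset.mem_union, Finset.mem_insert, Finset.mem_image, Finset.mem_Icc]; (clear * - hm hinj hy hw hz hyw hyz hwz; grind))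
      rw [show 1 + 1 + (m + 1 - 3) + 1 = m + 1 by omega] at q
      exact nc _ _ _ q hw2
    have nm2 : ¬ A (X m) (X 2) := by
      have q := (((P.single (X 2)).snoc h2w (by
        simp only [Finset.mem_singleton]; (clear * - hm hinj hy hw hz hyw hyz hwz; grind))).snoc h1 (by
        simp only [Finset.mem_singleton, Finset.mem_insert]; (clear * - hm hinj hy hw hz hyw hyz hwz; grind))).app
          (sg 3 m (by omega) (by omega) le_rfl) h3 (by
        simp only [Finset.mem_singleton, Finset.mem_insert, Finset.mem_image, Finset.mem_Icc]; (clear * - hm hinj hy hw hz hyw hyz hwz; grind))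
      rw [show 1 + 1 + 1 + (m + 1 - 3) = m + 1 by omega] at q
      exact nc _ _ _ q
    have dz := (pC.deg hcard hirr nc hw2 z y
      (by simp only [Finset.mem_insert, Finset.mem_image, Finset.mem_Icc]; (clear * - hm hinj hy hw hz hyw hyz hwz; grind))
      (by simp only [Finset.mem_insert, Finset.mem_image, Finset.mem_Icc]; (clear * - hm hinj hy hw hz hyw hyz hwz; grind)) hyz.symm).1
    have q := ((P.single y).snoc ayz (by simp only [Finset.mem_singleton]; (clear * - hm hinj hy hw hz hyw hyz hwz; grind))).app
          (sg 3 m (by omega) (by omega) le_rfl) h3 (by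
        simp only [Finset.mem_singleton, Finset.mem_insert, Finset.mem_image, Finset.mem_Icc]; (clear * - hm hinj hy hw hz hyw hyz hwz; grind))
    rw [show 1 + 1 + (m + 1 - 3) = m by omega] at q
    have d2 := (q.deg hcard hirr nc hmy (X 2) w
      (by simp only [Finset.mem_singleton, Finset.mem_union, Finset.mem_insert, Finset.mem_image, Finset.mem_Icc]; (clear * - hm hinj hy hw hz hyw hyz hwz; grind))
      (by simp only [Finset.mem_singleton, Finset.mem_union, Finset.mem_insert, Finset.mem_image, Finset.mem_Icc]; (clear * - hm hinj hy hw hz hyw hyz hwz; grind))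
      (hw 2 le_rfl (by omega))).2 n2y nm2
    have := (hstar z (X 2) (hz 2 le_rfl (by omega)).symm nz2 n2z ⟨y, ayz, hy2⟩).1
    rw [hcard] at this
    rw [e_neg (nwzy h1)] at dz
    have := e_le (A := A) (X 2) w
    have := e_le (A := A) w (X 2)
    omega
  have factF : A w z → ∀ j, 2 ≤ j → j + 1 ≤ m → A (X j) w → ¬ A z (X (j + 1)) := by
    intro h1 j hj hjm hjw h3
    rcases Nat.eq_or_lt_of_le hj with h | hj3
    · subst h; exact fin h1 h3
    have q := ((((sg 3 j (by omega) (by omega) (by omega)).snoc hjw (by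
      simp only [Finset.mem_image, Finset.mem_Icc]; (clear * - hm hinj hy hw hz hyw hyz hwz hj hjm hj3; grind))).snoc h1 (by
      simp only [Finset.mem_insert, Finset.mem_image, Finset.mem_Icc]; (clear * - hm hinj hy hw hz hyw hyz hwz hj hjm hj3; grind))).app
        (sg (j+1) m (by omega) (by omega) le_rfl) h3 (by
      simp only [Finset.mem_insert, Finset.mem_image, Finset.mem_Icc]; (clear * - hm hinj hy hw hz hyw hyz hwz hj hjm hj3; grind))).snoc hmy (by
      simp only [Finset.mem_union, Finset.mem_insert, Finset.mem_image, Finset.mem_Icc]; (clear * - hm hinj hy hw hz hyw hyz hwz hj hjm hj3; grind))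
    rw [show j + 1 - 3 + 1 + 1 + (m + 1 - (j + 1)) + 1 = m + 1 by omega] at q
    exact nc _ _ _ q hy3
  have factG : ∀ j, 3 ≤ j → j + 1 ≤ m → A (X j) z → ¬ A w (X (j + 1)) := by
    intro j hj hjm hjz h3
    have q := ((((sg 3 j (by omega) (by omega) (by omega)).snoc hjz (by
      simp only [Finset.mem_image, Finset.mem_Icc]; (clear * - hm hinj hy hw hz hyw hyz hwz hj hjm; grind))).snoc azw (by
      simp only [Finset.mem_insert, Finset.mem_image, Finset.mem_Icc]; (clear * - hm hinj hy hw hz hyw hyz hwz hj hjm; grind))).app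
        (sg (j+1) m (by omega) (by omega) le_rfl) h3 (by
      simp only [Finset.mem_insert, Finset.mem_image, Finset.mem_Icc]; (clear * - hm hinj hy hw hz hyw hyz hwz hj hjm; grind))).snoc hmy (by
      simp only [Finset.mem_union, Finset.mem_insert, Finset.mem_image, Finset.mem_Icc]; (clear * - hm hinj hy hw hz hyw hyz hwz hj hjm; grind))
    rw [show j + 1 - 3 + 1 + 1 + (m + 1 - (j + 1)) + 1 = m + 1 by omega] at q
    exact nc _ _ _ q hy3
  have ones : ∀ j, 2 ≤ j → j ≤ m → A (X j) w := by
    intro j hj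
    induction j, hj using Nat.le_induction with
    | base => intro _; exact h2w
    | succ j hj ih =>
      intro hjm
      rcases Nat.eq_or_lt_of_le hjm with h | hlt
      · rw [h]; exact hmw
      by_contra hn
      have hjw := ih (by omega)
      have hw' := eqw (j+1) (by omega) (by omega) hn
      have hn' := insw j hj hjm hjw
      have nz := factG (j+1) (by omega) (by omega)
      have q := (((sg 2 j (by omega) (by omega) (by omega)).snoc hjw (by
        simp only [Finset.mem_image, Finset.mem_Icc]; (clear * - hm hinj hy hw hz hyw hyz hwz hj hjm hlt; grind))).app
          (sg (j+1+1) m (by omega) (by omega) le_rfl) hw' (by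
        simp only [Finset.mem_insert, Finset.mem_image, Finset.mem_Icc]; (clear * - hm hinj hy hw hz hyw hyz hwz hj hjm hlt; grind))).snoc hmy (by
        simp only [Finset.mem_union, Finset.mem_insert, Finset.mem_image, Finset.mem_Icc]; (clear * - hm hinj hy hw hz hyw hyz hwz hj hjm hlt; grind))
      rw [show j + 1 - 2 + 1 + (m + 1 - (j + 1 + 1)) + 1 = m by omega] at q
      have dj := (q.deg hcard hirr nc hy2 (X (j+1)) z
        (by simp only [Finset.mem_union, Finset.mem_insert, Finset.mem_image, Finset.mem_Icc]; (clear * - hm hinj hy hw hz hyw hyz hwz hj hjm hlt; grind))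
        (by simp only [Finset.mem_union, Finset.mem_insert, Finset.mem_image, Finset.mem_Icc]; (clear * - hm hinj hy hw hz hyw hyz hwz hj hjm hlt; grind))
        (hz _ (by omega) (by omega))).1
      have ds := (hstar w (X (j+1)) (hw _ (by omega) (by omega)).symm hn' hn
        ⟨X j, hjw, hA j (by omega) (by omega)⟩).1
      rw [hcard] at ds
      have hnz : ¬ A (X (j+1)) z := fun h => nz h hw'
      rw [e_neg hnz] at dj
      have e6 := e_le (A := A) z (X (j+1))
      have awz : A w z := by
        by_contra h; rw [e_neg h] at *; omega
      have azj : A z (X (j+1)) := by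
        by_contra h; rw [e_neg h] at *; omega
      exact factF awz j hj hjm hjw azj
  have awz : A w z := by
    obtain ⟨t, ht, hwt⟩ := out2 (hout w) (X 2)
    rcases hall t with rfl | rfl | rfl | ⟨j, hj, hjm, rfl⟩
    · exact absurd hwt nwy
    · exact absurd hwt (hirr _)
    · exact hwt
    · have : j ≠ 2 := by rintro rfl; exact ht rfl
      obtain ⟨j, rfl⟩ : ∃ j', j = j' + 1 := ⟨j - 1, by omega⟩
      exact absurd hwt (insw j (by omega) hjm (ones j (by omega) (by omega)))
  obtain ⟨t, ht, hzt⟩ := out2 (hout z) w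
  rcases hall t with rfl | rfl | rfl | ⟨j, hj, hjm, rfl⟩
  · exact nwzy awz hzt
  · exact ht rfl
  · exact hirr _ hzt
  · have : j ≠ 2 := by rintro rfl; exact nz2 hzt
    obtain ⟨j, rfl⟩ : ∃ j', j = j' + 1 := ⟨j - 1, by omega⟩
    exact factF awz j (by omega) hjm (ones j (by omega) (by omega)) hzt

end DK

/-- Claim 5. -/
theorem darbinyan_karapetyan_claim5 {V : Type*} [Fintype V] (A : V → V → Prop)
    (hirr : ∀ v : V, ¬A v v)
    (hn : 5 ≤ Fintype.card V)
    (hstrong : IsStrong A)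
    (hsemi : MinSemiDegreeGE A 2)
    (hstar : CondStar A)
    (hnoCn1 : ¬HasCycle A (Fintype.card V - 1))
    (x : ℕ → V)
    (hper : ∀ i : ℕ, x (i + (Fintype.card V - 2)) = x i)
    (hinjC : ∀ i j : ℕ, i < Fintype.card V - 2 → j < Fintype.card V - 2 → x i = x j → i = j)
    (hcyc : ∀ i : ℕ, A (x i) (x (i + 1)))
    (y z : V) (hyz : y ≠ z)
    (hy : ∀ i : ℕ, y ≠ x i) (hz : ∀ i : ℕ, z ≠ x i)
    (i : ℕ)
    (h1 : A (x i) y)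
    (h2 : ¬A y (x (i + 1))) (h3 : ¬A (x (i + 1)) y) :
    ¬(A y (x (i + 2)) ∧ A y (x (i + 3))) := by
  rintro ⟨h4, h5⟩
  obtain ⟨m, hm⟩ : ∃ m, Fintype.card V = m + 2 := ⟨Fintype.card V - 2, by omega⟩
  rw [hm] at hper hinjC hnoCn1
  simp only [Nat.add_sub_cancel] at hper hinjC
  rw [show m + 2 - 1 = m + 1 by omega] at hnoCn1
  have hm3 : 3 ≤ m := by omega
  have hmod : ∀ a, x a = x (a % m) := by
    intro a
    exact ((Function.Periodic.map_mod_nat hper) a).symm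
  have hinj : ∀ a b : ℕ, 1 ≤ a → a ≤ m → 1 ≤ b → b ≤ m → x (i + a) = x (i + b) → a = b := by
    intro a b ha ham hb hbm h
    rw [hmod (i + a), hmod (i + b)] at h
    have h' : (i + a) ≡ (i + b) [MOD m] :=
      hinjC _ _ (Nat.mod_lt _ (by omega)) (Nat.mod_lt _ (by omega)) h
    have h'' : a ≡ b [MOD m] := Nat.ModEq.add_left_cancel' i h'
    rcases Nat.lt_or_ge a m with h1 | h1 <;> rcases Nat.lt_or_ge b m with h2 | h2
    · exact Nat.ModEq.eq_of_lt_of_lt h'' h1 h2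
    · have : b = m := by omega
      subst this
      have h3 : a % b = b % b := h''
      rw [Nat.mod_self, Nat.mod_eq_of_lt h1] at h3; omega
    · have : a = m := by omega
      subst this
      have h3 : a % a = b % a := h''
      rw [Nat.mod_self, Nat.mod_eq_of_lt h2] at h3; omega
    · omega
  refine DK.core m hm3 hm hirr (fun v => (hsemi v).1) hstar
    (fun a b S hp hba => hnoCn1 (hp.cycle hba)) (fun j => x (i + j))
    (fun a b ha ham hb hbm h => hinj a b (by omega) ham (by omega) hbm h)
    (fun j _ _ => hcyc (i + j)) y (x (i + 1)) z (hy _) hyz (hz _).symm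
    (fun j _ _ => (hy _).symm) ?_ (fun j _ _ => (hz _).symm) ?_ ?_ (hcyc (i + 1)) h4 h5 h2 h3
  · intro j hj hjm h
    have := hinj j 1 (by omega) hjm le_rfl (by omega) h
    omega
  · simp only [hper]; exact h1
  · simp only [hper]; exact hcyc i
end
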